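/- Let u ∈ (−1, 0) and λ ∈ ℝ. Then there exists a constant c_u > 0 such that for every function v of the form v(x) = (1+x²)^{−(1+iλ)/2} e^{iθ(x)} Φ(e^{2iθ(x)}) with Φ : S¹ → ℂ smooth and θ(x) = arccot(x) ∈ (0,π) (i.e. every smooth vector of the nonspherical principal series P(iλ,−)^∞ in the noncompact picture): ⫴v⫴²_u := ∫₀^{2π} ∫_ℝ |ξ|^{−u} |𝓕(π_{iλ,−}(k_{θ₀}) v)(ξ)|² dξ dθ₀ ≤ c_u ∫_ℝ |ξ|^{−u} |𝓕( (1+x²)^{(iλ−u)/2} e^{iθ(x)} v(x) )(ξ)|² dξ, as an inequality in [0,∞]. -/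

import Mathlib

open MeasureTheory Real Set Filter Complex
open scoped ENNReal NNReal

noncomputable section

/-- The weight-`2m` K-type vector `v_{2m}^{(u)}(x) = (1+x²)^{−(1+u)/2} ((1+xi)/(1−xi))^m`
of the principal series `P(u,+)` in the noncompact picture. -/
def vEven (u : ℂ) (m : ℤ) (x : ℝ) : ℂ :=
  ((1 + x ^ 2 : ℝ) : ℂ) ^ (-(1 + u) / 2) *
    ((1 + (x : ℂ) * Complex.I) / (1 - (x : ℂ) * Complex.I)) ^ m

/-- `z` is the improper Fourier transform of `g` at `ξ`:
`z = lim_{R→∞} ∫_{−R}^R g(x) e^{−2πixξ} dx`. -/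
def IsImpFT (g : ℝ → ℂ) (ξ : ℝ) (z : ℂ) : Prop :=
  Filter.Tendsto
    (fun R : ℝ => ∫ x in Set.Ioc (-R) R,
      g x * Complex.exp (-2 * (Real.pi : ℂ) * Complex.I * (x : ℂ) * (ξ : ℂ)))
    Filter.atTop (nhds z)

/-- The principal-series rotation action
`(π_{s,+}(k_θ)v)(x) = |cos θ − x sin θ|^{−1−s} v((x cos θ + sin θ)/(cos θ − x sin θ))`. -/
def piPlus (s : ℂ) (θ : ℝ) (v : ℝ → ℂ) (x : ℝ) : ℂ :=
  ((|Real.cos θ - x * Real.sin θ| : ℝ) : ℂ) ^ (-1 - s) *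
    v ((x * Real.cos θ + Real.sin θ) / (Real.cos θ - x * Real.sin θ))

/-- The nonspherical principal-series rotation action, with the sign factor
`sgn(cos θ − x sin θ)`. -/
def piMinus (s : ℂ) (θ : ℝ) (v : ℝ → ℂ) (x : ℝ) : ℂ :=
  ((Real.sign (Real.cos θ - x * Real.sin θ) : ℝ) : ℂ) *
    ((|Real.cos θ - x * Real.sin θ| : ℝ) : ℂ) ^ (-1 - s) *
    v ((x * Real.cos θ + Real.sin θ) / (Real.cos θ - x * Real.sin θ))

/-- `arccot x = π/2 − arctan x ∈ (0, π)`. -/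
def arccot (x : ℝ) : ℝ := Real.pi / 2 - Real.arctan x

open FourierTransform SchwartzMap in
/-- The `L²` Fourier transform of `f ∈ L¹ ∩ L²` is given by the Fourier integral. -/
theorem fourier_toLp_ae_eq {f : ℝ → ℂ} (h1 : Integrable f) (h2 : MemLp f 2) :
    (𝓕 (h2.toLp f) : Lp ℂ 2 (volume : Measure ℝ)) =ᵐ[volume] 𝓕 f := by
  apply ae_eq_of_integral_contDiff_smul_eq
  · exact (Lp.memLp _).locallyIntegrable (by norm_num)
  · apply Continuous.locallyIntegrable
    exact VectorFourier.fourierIntegral_continuous Real.continuous_fourierChar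
      (by exact continuous_inner) h1
  · intro φ hφ hc
    have hc' : HasCompactSupport (fun x => (φ x : ℂ)) := hc.comp_left (g := ((↑) : ℝ → ℂ)) (by simp)
    have hφ' : ContDiff ℝ ((⊤ : ℕ∞) : WithTop ℕ∞) (fun x => (φ x : ℂ)) :=
      Complex.ofRealCLM.contDiff.comp hφ
    set Φ : 𝓢(ℝ, ℂ) := hc'.toSchwartzMap hφ' with hΦ
    have key := congrArg (fun T => T Φ)
      (MeasureTheory.Lp.fourier_toTemperedDistribution_eq (h2.toLp f))
    simp only [TemperedDistribution.fourier_apply, Lp.toTemperedDistribution_apply] at key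
    have e1 : ∀ x, Φ x = (φ x : ℂ) := fun x => rfl
    simp only [e1] at key
    have e2 : ∫ x, (φ x) • ((𝓕 (h2.toLp f) : Lp ℂ 2 (volume : Measure ℝ)) x) =
      ∫ x, (φ x : ℂ) • ((𝓕 (h2.toLp f) : Lp ℂ 2 (volume : Measure ℝ)) x) := by
      simp [Complex.real_smul]
    rw [e2, ← key]
    have e3 : ∫ x, (𝓕 Φ) x • (h2.toLp f) x = ∫ x, (𝓕 Φ) x • f x := by
      apply integral_congr_ae
      filter_upwards [h2.coeFn_toLp] with x hx
      rw [hx]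
    rw [e3]
    have := VectorFourier.integral_fourierIntegral_smul_eq_flip (f := (Φ : ℝ → ℂ)) (g := f)
      (μ := volume) (ν := volume) (L := innerₗ ℝ)
      Real.continuous_fourierChar (by exact continuous_inner) Φ.integrable h1
    rw [flip_innerₗ] at this
    simp only [SchwartzMap.fourier_coe]
    refine this.trans ?_
    simp [Complex.real_smul, e1]
    rfl

open FourierTransform in
/-- Plancherel's theorem for `f ∈ L¹ ∩ L²`. -/
theorem lintegral_enorm_fourier_sq {f : ℝ → ℂ} (h1 : Integrable f) (h2 : MemLp f 2) :
    ∫⁻ ξ, ‖𝓕 f ξ‖ₑ ^ 2 = ∫⁻ x, ‖f x‖ₑ ^ 2 := by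
  have hn : ‖(𝓕 (h2.toLp f) : Lp ℂ 2 (volume : Measure ℝ))‖ₑ = ‖h2.toLp f‖ₑ := by
    rw [← ofReal_norm, ← ofReal_norm, MeasureTheory.Lp.norm_fourier_eq]
  rw [Lp.enorm_def, Lp.enorm_def, eLpNorm_congr_ae (fourier_toLp_ae_eq h1 h2),
    eLpNorm_congr_ae h2.coeFn_toLp] at hn
  have hs : ∀ g : ℝ → ℂ, ∫⁻ x, ‖g x‖ₑ ^ 2 = eLpNorm g 2 volume ^ 2 := by
    intro g
    rw [eLpNorm_eq_lintegral_rpow_enorm_toReal (by norm_num) (by norm_num),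
      ← ENNReal.rpow_natCast, ← ENNReal.rpow_mul]
    simp
  rw [hs, hs, hn]

/-- `f` is continuously differentiable with integrable derivative `f'`, and vanishes at `±∞`. -/
structure IsDecayingC1 (f f' : ℝ → ℂ) : Prop where
  hasDerivAt : ∀ x, HasDerivAt f (f' x) x
  continuous' : Continuous f'
  integrable' : Integrable f'
  tendsto_atTop : Tendsto f atTop (nhds 0)
  tendsto_atBot : Tendsto f atBot (nhds 0)

open FourierTransform in
/-- The Fourier transform of a decaying function, computed from its derivative `f'`. -/
def derivFT (f' : ℝ → ℂ) (ξ : ℝ) : ℂ := 𝓕 f' ξ / (2 * π * Complex.I * ξ)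

/-- The Gagliardo (Sobolev–Slobodeckij) energy of order `a / 2`. -/
def gagliardo (a : ℝ) (f : ℝ → ℂ) : ℝ≥0∞ :=
  ∫⁻ x, ∫⁻ y, ENNReal.ofReal (‖f x - f y‖ ^ 2 * |x - y| ^ (-(1 + a)))

/-- The constant relating the Gagliardo energy and the Fourier side. -/
def gagliardoConst (a : ℝ) : ℝ≥0∞ :=
  ∫⁻ t : ℝ, ENNReal.ofReal (‖Complex.exp (2 * π * Complex.I * t) - 1‖ ^ 2 * |t| ^ (-(1 + a)))

namespace IsDecayingC1

variable {f f' : ℝ → ℂ}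

theorem differentiable (h : IsDecayingC1 f f') : Differentiable ℝ f :=
  fun x => (h.hasDerivAt x).differentiableAt

theorem continuous (h : IsDecayingC1 f f') : Continuous f := h.differentiable.continuous

theorem isImpFT (h : IsDecayingC1 f f') {ξ : ℝ} (hξ : ξ ≠ 0) : IsImpFT f ξ (derivFT f' ξ) := by
  set k : ℂ := -2 * π * Complex.I * ξ with hk
  have hk0 : k ≠ 0 := by
    simp [hk, Real.pi_ne_zero, hξ, Complex.I_ne_zero]
  set E : ℝ → ℂ := fun x => Complex.exp (-2 * π * Complex.I * x * ξ) / k with hE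
  have hEd : ∀ x : ℝ, HasDerivAt E (Complex.exp (-2 * π * Complex.I * x * ξ)) x := by
    intro x
    have h1 : HasDerivAt (fun x : ℝ => -2 * (π : ℂ) * Complex.I * x * ξ) k x := by
      have := ((hasDerivAt_id x).ofReal_comp.const_mul (-2 * (π : ℂ) * Complex.I)).mul_const (ξ : ℂ)
      simpa [hk] using this
    have h2 := h1.cexp.div_const k
    rwa [mul_div_cancel_right₀ _ hk0] at h2
  have hEn : ∀ x : ℝ, ‖E x‖ = ‖k‖⁻¹ := by
    intro x
    have : -2 * (π : ℂ) * Complex.I * x * ξ = ((-2 * π * x * ξ : ℝ) : ℂ) * Complex.I := by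
      push_cast; ring
    simp only [hE, norm_div, this, Complex.norm_exp_ofReal_mul_I, one_div]
  have hEc : Continuous E := by fun_prop
  have hbd : ∀ l : Filter ℝ, Tendsto f l (nhds 0) → Tendsto (fun x => f x * E x) l (nhds 0) := by
    intro l hl
    rw [tendsto_zero_iff_norm_tendsto_zero] at hl ⊢
    simp only [norm_mul, hEn]
    simpa using hl.mul_const (‖k‖⁻¹)
  have hint : Integrable (fun x => f' x * E x) :=
    h.integrable'.mul_bdd (c := ‖k‖⁻¹) hEc.aestronglyMeasurable
      (Filter.Eventually.of_forall fun x => (hEn x).le)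
  have hlim : Tendsto (fun R : ℝ => f R * E R - f (-R) * E (-R) - ∫ x in (-R)..R, f' x * E x)
      atTop (nhds (0 - 0 - ∫ x, f' x * E x)) := by
    refine ((hbd _ h.tendsto_atTop).sub ?_).sub ?_
    · exact (hbd _ h.tendsto_atBot).comp tendsto_neg_atTop_atBot
    · exact intervalIntegral_tendsto_integral hint tendsto_neg_atTop_atBot tendsto_id
  have hval : (0 - 0 - ∫ x, f' x * E x) = derivFT f' ξ := by
    have : ∀ x : ℝ, f' x * E x
        = (Complex.exp (↑(-2 * π * x * ξ) * Complex.I) • f' x) * k⁻¹ := by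
      intro x
      have e : -2 * (π : ℂ) * Complex.I * x * ξ = ↑(-2 * π * x * ξ) * Complex.I := by
        push_cast; ring
      simp only [hE, e, smul_eq_mul, div_eq_mul_inv]; ring
    simp only [this]
    rw [integral_mul_const, ← Real.fourier_real_eq_integral_exp_smul, derivFT, hk]
    simp only [div_eq_mul_inv, neg_mul, inv_neg]
    ring
  rw [← hval]
  refine hlim.congr' ?_
  filter_upwards [eventually_ge_atTop 0] with R hR
  rw [← intervalIntegral.integral_of_le (by linarith)]
  refine (intervalIntegral.integral_mul_deriv_eq_deriv_mul_of_hasDerivAt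
    h.continuous.continuousOn hEc.continuousOn (fun x _ => h.hasDerivAt x) (fun x _ => hEd x)
    (h.continuous'.intervalIntegrable _ _) ?_).symm
  exact Continuous.intervalIntegrable (by fun_prop) _ _

theorem sub_eq_integral (h : IsDecayingC1 f f') (x t : ℝ) :
    f (x + t) - f x = ∫ s in (0 : ℝ)..t, f' (x + s) := by
  have := intervalIntegral.integral_eq_sub_of_hasDerivAt (f := f) (f' := f') (a := x) (b := x + t)
    (fun y _ => h.hasDerivAt y) (h.continuous'.intervalIntegrable _ _)
  rw [← this, intervalIntegral.integral_comp_add_left]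
  simp

theorem integrable_sub (h : IsDecayingC1 f f') (t : ℝ) :
    Integrable (fun x => f (x + t) - f x) := by
  simp only [h.sub_eq_integral, intervalIntegral.intervalIntegral_eq_integral_uIoc]
  refine Integrable.smul _ ?_
  have : Integrable (fun p : ℝ × ℝ => f' (p.1 + p.2))
      (volume.prod (volume.restrict (uIoc 0 t))) := by
    have hm : Continuous (fun p : ℝ × ℝ => f' (p.1 + p.2)) :=
      h.continuous'.comp (continuous_fst.add continuous_snd)
    rw [integrable_prod_iff' hm.aestronglyMeasurable]
    refine ⟨Filter.Eventually.of_forall fun y => h.integrable'.comp_add_right y, ?_⟩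
    simp only [integral_add_right_eq_self (fun x => ‖f' x‖)]
    have : IsFiniteMeasure (volume.restrict (uIoc 0 t)) := by unfold uIoc; infer_instance
    exact integrable_const _
  exact this.integral_prod_left

theorem norm_sub_le (h : IsDecayingC1 f f') (x t : ℝ) :
    ‖f (x + t) - f x‖ ≤ ∫ s, ‖f' s‖ := by
  rw [h.sub_eq_integral]
  refine (intervalIntegral.norm_integral_le_integral_norm_uIoc).trans ?_
  rw [← integral_add_left_eq_self (fun s => ‖f' s‖) x]
  exact setIntegral_le_integral ((h.integrable'.comp_add_left x).norm)
    (Filter.Eventually.of_forall fun _ => norm_nonneg _)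

theorem memLp_sub (h : IsDecayingC1 f f') (t : ℝ) :
    MemLp (fun x => f (x + t) - f x) 2 := by
  have hc := h.continuous
  rw [memLp_two_iff_integrable_sq_norm (by fun_prop)]
  refine (((h.integrable_sub t).norm).const_mul (∫ s, ‖f' s‖)).mono'
    (by fun_prop) (Filter.Eventually.of_forall fun x => ?_)
  rw [norm_pow, norm_norm, sq]
  exact mul_le_mul_of_nonneg_right (h.norm_sub_le x t) (norm_nonneg _)

open FourierTransform in
theorem fourier_sub (h : IsDecayingC1 f f') (t : ℝ) {ξ : ℝ} (hξ : ξ ≠ 0) :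
    𝓕 (fun x => f (x + t) - f x) ξ =
      (Complex.exp (2 * π * Complex.I * (t * ξ : ℝ)) - 1) * derivFT f' ξ := by
  have hd : ∀ x, HasDerivAt (fun x => f (x + t) - f x) (f' (x + t) - f' x) x := fun x =>
    ((h.hasDerivAt (x + t)).comp_add_const x t).sub (h.hasDerivAt x)
  have hde : deriv (fun x => f (x + t) - f x) = fun x => f' (x + t) - f' x :=
    funext fun x => (hd x).deriv
  have h1 := congrFun (Real.fourier_deriv (h.integrable_sub t)
    (fun x => (hd x).differentiableAt)
    (by rw [hde]; exact (h.integrable'.comp_add_right t).sub h.integrable')) ξ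
  rw [hde] at h1
  have h2 : 𝓕 (fun x => f' (x + t) - f' x) ξ =
      (Complex.exp (2 * π * Complex.I * (t * ξ : ℝ)) - 1) * 𝓕 f' ξ := by
    have h3 := congrFun (Fourier.fourierIntegral_comp_add_right Real.fourierChar volume f' t) ξ
    have h4 : 𝓕 (fun x => f' (x + t)) ξ =
        Complex.exp (2 * π * Complex.I * (t * ξ : ℝ)) * 𝓕 f' ξ := by
      refine (Real.fourier_real_eq _ _).trans ?_
      rw [Real.fourier_real_eq]
      simp only [Fourier.fourierIntegral_def, Function.comp_def] at h3
      rw [h3, Circle.smul_def, Real.fourierChar_apply, smul_eq_mul]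
      congr 2
      push_cast; ring
    rw [sub_mul, ← h4, one_mul]
    simp only [Real.fourier_real_eq, smul_sub]
    rw [integral_sub]
    · exact (Real.fourierIntegral_convergent_iff' (ContinuousLinearMap.mul ℝ ℝ) ξ).2
        (h.integrable'.comp_add_right t)
    · exact (Real.fourierIntegral_convergent_iff' (ContinuousLinearMap.mul ℝ ℝ) ξ).2 h.integrable'
  rw [h2, smul_eq_mul] at h1
  have hk0 : (2 * π * Complex.I * ξ : ℂ) ≠ 0 := by
    simp [Real.pi_ne_zero, hξ, Complex.I_ne_zero]
  rw [derivFT, mul_div_assoc', h1, mul_div_cancel_left₀ _ hk0]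

end IsDecayingC1

theorem lintegral_eq_abs_mul_comp_mul (φ : ℝ → ℝ≥0∞) {c : ℝ} (hc : c ≠ 0) :
    ∫⁻ x, φ x = ENNReal.ofReal |c| * ∫⁻ x, φ (c * x) := by
  conv_lhs => rw [← Real.smul_map_volume_mul_left hc]
  rw [lintegral_smul_measure, smul_eq_mul]
  congr 1
  exact (Homeomorph.mulLeft₀ c hc).measurableEmbedding.lintegral_map φ

theorem measurable_gagliardo_kernel {f : ℝ → ℂ} (hf : Continuous f) (a : ℝ) :
    Measurable (fun p : ℝ × ℝ =>
      ENNReal.ofReal (‖f p.1 - f p.2‖ ^ 2 * |p.1 - p.2| ^ (-(1 + a)))) := by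
  have h1 : Measurable (fun p : ℝ × ℝ => ‖f p.1 - f p.2‖ ^ 2) :=
    (by fun_prop : Continuous _).measurable
  have h2 : Measurable (fun p : ℝ × ℝ => |p.1 - p.2| ^ (-(1 + a))) :=
    (by fun_prop : Continuous fun p : ℝ × ℝ => |p.1 - p.2|).measurable.pow_const _
  exact (h1.mul h2).ennreal_ofReal

theorem gagliardoConst_scale (a : ℝ) {ξ : ℝ} (hξ : ξ ≠ 0) :
    ∫⁻ t : ℝ, ENNReal.ofReal
      (‖Complex.exp (2 * π * Complex.I * (t * ξ : ℝ)) - 1‖ ^ 2 * |t| ^ (-(1 + a)))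
      = ENNReal.ofReal (|ξ| ^ a) * gagliardoConst a := by
  have hp : 0 < |ξ| := abs_pos.2 hξ
  rw [gagliardoConst]
  conv_rhs => rw [lintegral_eq_abs_mul_comp_mul _ hξ]
  rw [← mul_assoc, ← ENNReal.ofReal_mul (by positivity),
    ← lintegral_const_mul' _ _ ENNReal.ofReal_ne_top]
  congr 1 with t
  rw [← ENNReal.ofReal_mul (by positivity), abs_mul, Real.mul_rpow hp.le (abs_nonneg t),
    mul_comm t ξ]
  congr 1
  have : |ξ| ^ a * |ξ| * |ξ| ^ (-(1 + a)) = 1 := by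
    rw [← Real.rpow_add_one hp.ne', ← Real.rpow_add hp]
    rw [show a + 1 + -(1 + a) = 0 by ring, Real.rpow_zero]
  linear_combination (-‖Complex.exp (2 * π * Complex.I * (ξ * t : ℝ)) - 1‖ ^ 2 * |t| ^ (-(1 + a)))
    * this

theorem gagliardo_eq_shift {f : ℝ → ℂ} (hf : Continuous f) (a : ℝ) :
    gagliardo a f = ∫⁻ t, ENNReal.ofReal (|t| ^ (-(1 + a))) *
      ∫⁻ x, ‖f (x + t) - f x‖ₑ ^ 2 := by
  have h1 : gagliardo a f = ∫⁻ x, ∫⁻ t,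
      ENNReal.ofReal (‖f x - f (x + t)‖ ^ 2 * |x - (x + t)| ^ (-(1 + a))) := by
    unfold gagliardo
    congr 1 with x
    rw [← lintegral_add_left_eq_self _ x]
  rw [h1, lintegral_lintegral_swap]
  · congr 1 with t
    rw [← lintegral_const_mul' _ _ ENNReal.ofReal_ne_top]
    congr 1 with x
    rw [mul_comm, ENNReal.ofReal_mul (by positivity), ENNReal.ofReal_pow (norm_nonneg _),
      ofReal_norm, enorm_sub_rev]
    simp
  · exact ((measurable_gagliardo_kernel hf a).comp
      (measurable_fst.prodMk (measurable_fst.add measurable_snd))).aemeasurable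

theorem IsDecayingC1.gagliardo_eq {f f' : ℝ → ℂ} (h : IsDecayingC1 f f') (a : ℝ) :
    gagliardo a f = gagliardoConst a *
      ∫⁻ ξ : ℝ, ENNReal.ofReal (|ξ| ^ a) * ‖derivFT f' ξ‖ₑ ^ 2 := by
  have hm : Measurable (derivFT f') := by
    have : Continuous (FourierTransform.fourier f') :=
      VectorFourier.fourierIntegral_continuous Real.continuous_fourierChar
        (by exact continuous_inner) h.integrable'
    exact this.measurable.div (by fun_prop)
  have h0 : ∀ᵐ ξ : ℝ, ξ ≠ 0 := by simp [ae_iff]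
  rw [gagliardo_eq_shift h.continuous]
  have h1 : ∀ t : ℝ, ENNReal.ofReal (|t| ^ (-(1 + a))) * ∫⁻ x, ‖f (x + t) - f x‖ₑ ^ 2
      = ∫⁻ ξ, ENNReal.ofReal
        (‖Complex.exp (2 * π * Complex.I * (t * ξ : ℝ)) - 1‖ ^ 2 * |t| ^ (-(1 + a))) *
          ‖derivFT f' ξ‖ₑ ^ 2 := by
    intro t
    rw [← lintegral_enorm_fourier_sq (h.integrable_sub t) (h.memLp_sub t),
      ← lintegral_const_mul' _ _ ENNReal.ofReal_ne_top]
    apply lintegral_congr_ae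
    filter_upwards [h0] with ξ hξ
    rw [h.fourier_sub t hξ, enorm_mul, mul_pow, ENNReal.ofReal_mul (by positivity),
      ENNReal.ofReal_pow (norm_nonneg _), ofReal_norm]
    ring
  simp only [h1]
  rw [lintegral_lintegral_swap, ← lintegral_const_mul _ (by fun_prop)]
  · apply lintegral_congr_ae
    filter_upwards [h0] with ξ hξ
    rw [lintegral_mul_const' _ _ (by simp), gagliardoConst_scale a hξ]
    ring
  · have h3 : Measurable (fun p : ℝ × ℝ => ENNReal.ofReal
        (‖Complex.exp (2 * π * Complex.I * (p.1 * p.2 : ℝ)) - 1‖ ^ 2 * |p.1| ^ (-(1 + a)))) := by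
      have h4 : Measurable (fun p : ℝ × ℝ =>
          ‖Complex.exp (2 * π * Complex.I * (p.1 * p.2 : ℝ)) - 1‖ ^ 2) := by fun_prop
      have h5 : Measurable (fun p : ℝ × ℝ => |p.1| ^ (-(1 + a))) :=
        (by fun_prop : Continuous fun p : ℝ × ℝ => |p.1|).measurable.pow_const _
      exact (h4.mul h5).ennreal_ofReal
    exact (h3.mul ((hm.comp measurable_snd).enorm.pow_const 2)).aemeasurable

theorem lintegral_one_add_sq_rpow_lt_top {p : ℝ} (hp : 1 / 2 < p) :
    ∫⁻ x : ℝ, ENNReal.ofReal ((1 + x ^ 2) ^ (-p)) < ∞ := by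
  have h := integrable_rpow_neg_one_add_norm_sq (E := ℝ) (μ := volume) (r := 2 * p)
    (by simp; linarith)
  have h2 : (fun x : ℝ => (1 + ‖x‖ ^ 2) ^ (-(2 * p) / 2)) = fun x : ℝ => (1 + x ^ 2) ^ (-p) := by
    ext x
    rw [Real.norm_eq_abs, sq_abs]
    congr 1
    ring
  rw [h2] at h
  exact h.lintegral_lt_top

theorem lintegral_abs_rpow_lt_top {a : ℝ} (ha : a < 1) :
    ∫⁻ x in Icc (-1 : ℝ) 1, ENNReal.ofReal (|x| ^ (-a)) < ∞ := by
  have h : IntervalIntegrable (fun x : ℝ => |x| ^ (-a)) volume (-1) 1 := by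
    apply intervalIntegrable_of_even (fun x => by simp)
    intro x hx
    refine (intervalIntegral.intervalIntegrable_rpow' (r := -a) (by linarith)).congr ?_
    intro y hy
    rw [uIoc_of_le hx.le] at hy
    simp [abs_of_pos hy.1]
  rw [intervalIntegrable_iff_integrableOn_Icc_of_le (by norm_num)] at h
  exact h.lintegral_lt_top

theorem abs_rpow_neg_le {q t : ℝ} (hq : 0 ≤ q) (hq' : q ≤ 2) (ht : 1 ≤ |t|) :
    |t| ^ (-q) ≤ 2 * (1 + t ^ 2) ^ (-(q / 2)) := by
  have h0 : 0 < |t| := by linarith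
  have h1 : 1 + t ^ 2 ≤ 2 * t ^ 2 := by
    have := one_le_sq_iff_one_le_abs t |>.2 ht
    linarith
  have h2 : (2 * t ^ 2) ^ (-(q / 2)) ≤ (1 + t ^ 2) ^ (-(q / 2)) :=
    Real.rpow_le_rpow_of_nonpos (by positivity) h1 (by linarith)
  have h3 : (2 * t ^ 2) ^ (-(q / 2)) = 2 ^ (-(q / 2)) * |t| ^ (-q) := by
    rw [Real.mul_rpow (by norm_num) (by positivity), ← sq_abs t, ← Real.rpow_natCast,
      ← Real.rpow_mul h0.le]
    congr 2
    push_cast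
    ring
  have h4 : (2 : ℝ)⁻¹ ≤ 2 ^ (-(q / 2)) := by
    rw [← Real.rpow_neg_one]
    exact Real.rpow_le_rpow_of_exponent_le (by norm_num) (by linarith)
  have h5 : 0 ≤ |t| ^ (-q) := by positivity
  nlinarith

theorem lintegral_min_sq_mul_rpow_lt_top {a : ℝ} (ha : a ∈ Ioo (0 : ℝ) 1) :
    ∫⁻ t : ℝ, ENNReal.ofReal (min 1 (t ^ 2) * |t| ^ (-(1 + a))) < ∞ := by
  obtain ⟨h0, h1⟩ := ha
  have hle : ∀ t : ℝ, min 1 (t ^ 2) * |t| ^ (-(1 + a)) ≤ 2 * (1 + t ^ 2) ^ (-((1 + a) / 2)) := by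
    intro t
    rcases le_total 1 |t| with ht | ht
    · refine (mul_le_of_le_one_left (by positivity) (min_le_left _ _)).trans ?_
      exact abs_rpow_neg_le (by linarith) (by linarith) ht
    · have h2 : t ^ 2 ≤ 1 := (sq_le_one_iff_abs_le_one t).2 ht
      have h3 : (2 : ℝ)⁻¹ ≤ (1 + t ^ 2) ^ (-((1 + a) / 2)) := by
        calc (2 : ℝ)⁻¹ = 2 ^ (-1 : ℝ) := (Real.rpow_neg_one _).symm
          _ ≤ 2 ^ (-((1 + a) / 2)) := Real.rpow_le_rpow_of_exponent_le (by norm_num) (by linarith)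
          _ ≤ _ := Real.rpow_le_rpow_of_nonpos (by positivity) (by linarith) (by linarith)
      suffices min 1 (t ^ 2) * |t| ^ (-(1 + a)) ≤ 1 by linarith
      rcases eq_or_ne t 0 with rfl | h0'
      · simp
      have hp : 0 < |t| := abs_pos.2 h0'
      calc min 1 (t ^ 2) * |t| ^ (-(1 + a)) ≤ t ^ 2 * |t| ^ (-(1 + a)) := by
            gcongr; exact min_le_right _ _
        _ = |t| ^ (2 + -(1 + a)) := by
            rw [Real.rpow_add hp, Real.rpow_two, sq_abs]
        _ ≤ 1 := Real.rpow_le_one hp.le ht (by linarith)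
  calc _ ≤ ∫⁻ t : ℝ, ENNReal.ofReal (2 * (1 + t ^ 2) ^ (-((1 + a) / 2))) :=
        lintegral_mono fun t => ENNReal.ofReal_le_ofReal (hle t)
    _ = ENNReal.ofReal 2 * ∫⁻ t : ℝ, ENNReal.ofReal ((1 + t ^ 2) ^ (-((1 + a) / 2))) := by
        rw [← lintegral_const_mul' _ _ ENNReal.ofReal_ne_top]
        simp only [ENNReal.ofReal_mul (show (0 : ℝ) ≤ 2 by norm_num)]
    _ < ∞ := ENNReal.mul_lt_top (by simp) (lintegral_one_add_sq_rpow_lt_top (by linarith))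

theorem norm_exp_sub_one_sq_le (t : ℝ) :
    ‖Complex.exp (2 * π * Complex.I * t) - 1‖ ^ 2 ≤ 4 * π ^ 2 * min 1 (t ^ 2) := by
  have e : (2 * π * Complex.I * t : ℂ) = Complex.I * (2 * π * t : ℝ) := by push_cast; ring
  rw [mul_min_of_nonneg _ _ (by positivity), le_min_iff]
  constructor
  · have h1 : ‖Complex.exp (2 * π * Complex.I * t) - 1‖ ≤ 2 := by
      refine (norm_sub_le _ _).trans ?_
      rw [e, Complex.norm_exp_I_mul_ofReal, norm_one]; norm_num
    have := Real.pi_gt_three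
    nlinarith [norm_nonneg (Complex.exp (2 * π * Complex.I * t) - 1)]
  · have h1 : ‖Complex.exp (2 * π * Complex.I * t) - 1‖ ≤ ‖2 * π * t‖ := by
      rw [e]; exact Real.norm_exp_I_mul_ofReal_sub_one_le
    calc _ ≤ ‖2 * π * t‖ ^ 2 := by gcongr
      _ = _ := by rw [Real.norm_eq_abs, sq_abs]; ring

theorem gagliardoConst_lt_top {a : ℝ} (ha : a ∈ Ioo (0 : ℝ) 1) : gagliardoConst a < ∞ := by
  calc gagliardoConst a ≤ ∫⁻ t : ℝ, ENNReal.ofReal (4 * π ^ 2) *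
        ENNReal.ofReal (min 1 (t ^ 2) * |t| ^ (-(1 + a))) := by
        refine lintegral_mono fun t => ?_
        rw [← ENNReal.ofReal_mul (by positivity), ← mul_assoc]
        gcongr
        exact norm_exp_sub_one_sq_le t
    _ < ∞ := by
        rw [lintegral_const_mul' _ _ ENNReal.ofReal_ne_top]
        exact ENNReal.mul_lt_top ENNReal.ofReal_lt_top (lintegral_min_sq_mul_rpow_lt_top ha)

theorem gagliardoConst_ne_zero (a : ℝ) : gagliardoConst a ≠ 0 := by
  rw [gagliardoConst, Ne, lintegral_eq_zero_iff']
  · intro h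
    have h1 : ∀ᵐ t : ℝ, t ∉ Ioo (0 : ℝ) 1 := by
      filter_upwards [h] with t ht hmem
      simp only [Pi.zero_apply, ENNReal.ofReal_eq_zero] at ht
      have h2 : 0 < |t| ^ (-(1 + a)) := Real.rpow_pos_of_pos (abs_pos.2 hmem.1.ne') _
      have h3 : Complex.exp (2 * π * Complex.I * t) - 1 = 0 := by
        by_contra hne
        have := norm_pos_iff.2 hne
        have : 0 < ‖Complex.exp (2 * π * Complex.I * t) - 1‖ ^ 2 * |t| ^ (-(1 + a)) := by
          positivity
        linarith
      rw [sub_eq_zero, Complex.exp_eq_one_iff] at h3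
      obtain ⟨n, hn⟩ := h3
      have h4 : (t : ℂ) = n := by
        have hne : (2 * π * Complex.I : ℂ) ≠ 0 := by simp [Real.pi_ne_zero, Complex.I_ne_zero]
        apply mul_left_cancel₀ hne
        rw [hn]; ring
      have h5 : t = n := by exact_mod_cast h4
      rw [h5] at hmem
      obtain ⟨h6, h7⟩ := hmem
      have h8 : (0 : ℤ) < n := by exact_mod_cast h6
      have h9 : n < (1 : ℤ) := by exact_mod_cast h7
      omega
    have h10 : volume (Ioo (0 : ℝ) 1) = 0 := by
      rw [ae_iff] at h1
      simpa only [not_not, ofPred_mem_eq] using h1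
    simp at h10
  · apply Measurable.aemeasurable
    apply Measurable.ennreal_ofReal
    have h5 : Measurable (fun p : ℝ => |p| ^ (-(1 + a))) :=
        (by fun_prop : Continuous fun p : ℝ => |p|).measurable.pow_const _
    exact Measurable.mul (by fun_prop) h5

theorem arccot_mem_Ioo (x : ℝ) : arccot x ∈ Ioo 0 π := by
  have h1 := Real.arctan_lt_pi_div_two x
  have h2 := Real.neg_pi_div_two_lt_arctan x
  constructor <;> unfold arccot <;> linarith

theorem hasDerivAt_arccot (x : ℝ) : HasDerivAt arccot (-(1 + x ^ 2)⁻¹) x := by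
  exact ((Real.hasDerivAt_arctan x).const_sub (π / 2)).congr_deriv (by simp)

theorem continuous_arccot : Continuous arccot :=
  continuous_const.sub Real.continuous_arctan

theorem range_arccot : range arccot = Ioo 0 π := by
  ext t
  constructor
  · rintro ⟨x, rfl⟩
    exact arccot_mem_Ioo x
  · rintro ⟨h1, h2⟩
    refine ⟨Real.tan (π / 2 - t), ?_⟩
    rw [arccot, Real.arctan_tan (by linarith) (by linarith)]
    ring

theorem sin_arccot (x : ℝ) : Real.sin (arccot x) = 1 / √(1 + x ^ 2) := by
  rw [arccot, Real.sin_pi_div_two_sub, Real.cos_arctan]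

theorem cos_arccot (x : ℝ) : Real.cos (arccot x) = x / √(1 + x ^ 2) := by
  rw [arccot, Real.cos_pi_div_two_sub, Real.sin_arctan]

theorem lintegral_Ioo_zero_pi (Φ : ℝ → ℝ≥0∞) :
    ∫⁻ t in Ioo 0 π, Φ t = ∫⁻ x, ENNReal.ofReal ((1 + x ^ 2)⁻¹) * Φ (arccot x) := by
  rw [← range_arccot, ← image_univ, lintegral_image_eq_lintegral_abs_deriv_mul MeasurableSet.univ
    (fun x _ => (hasDerivAt_arccot x).hasDerivWithinAt), Measure.restrict_univ]
  · congr 1 with x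
    rw [abs_neg, abs_of_nonneg (by positivity)]
  · intro x _ y _ hxy
    exact Real.arctan_injective (by simpa [arccot] using hxy)

theorem abs_sin_arccot_sub (x y : ℝ) :
    |Real.sin (arccot x - arccot y)| =
      |x - y| * ((1 + x ^ 2) * (1 + y ^ 2)) ^ (-(1 / 2) : ℝ) := by
  rw [Real.sin_sub, sin_arccot, sin_arccot, cos_arccot, cos_arccot,
    Real.mul_rpow (by positivity) (by positivity), Real.rpow_neg (by positivity),
    Real.rpow_neg (by positivity), ← Real.sqrt_eq_rpow, ← Real.sqrt_eq_rpow, abs_sub_comm x y]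
  have h1 : 0 < √(1 + x ^ 2) := by positivity
  have h2 : 0 < √(1 + y ^ 2) := by positivity
  rw [show 1 / √(1 + x ^ 2) * (y / √(1 + y ^ 2)) - x / √(1 + x ^ 2) * (1 / √(1 + y ^ 2)) =
    (y - x) * ((√(1 + x ^ 2))⁻¹ * (√(1 + y ^ 2))⁻¹) by field_simp, abs_mul,
    abs_of_pos (by positivity : 0 < (√(1 + x ^ 2))⁻¹ * (√(1 + y ^ 2))⁻¹)]

/-- The function `(1 + x²)^{-c} P(arccot x)`. -/
def weighted (c : ℂ) (P : ℝ → ℂ) (x : ℝ) : ℂ :=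
  ((1 + x ^ 2 : ℝ) : ℂ) ^ (-c) * P (arccot x)

/-- The derivative of `weighted c P`. -/
def weightedDeriv (c : ℂ) (P P' : ℝ → ℂ) (x : ℝ) : ℂ :=
  ((1 + x ^ 2 : ℝ) : ℂ) ^ (-c - 1) * (-(2 * c * x) * P (arccot x) - P' (arccot x))

theorem norm_weighted (c : ℂ) (P : ℝ → ℂ) (x : ℝ) :
    ‖weighted c P x‖ = (1 + x ^ 2) ^ (-c.re) * ‖P (arccot x)‖ := by
  rw [weighted, norm_mul, Complex.norm_cpow_eq_rpow_re_of_pos (by positivity)]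
  simp

theorem continuous_one_add_sq_cpow (c : ℂ) :
    Continuous (fun x : ℝ => ((1 + x ^ 2 : ℝ) : ℂ) ^ c) := by
  refine Continuous.cpow (by fun_prop) continuous_const fun x => ?_
  exact Complex.ofReal_mem_slitPlane.2 (by positivity)

theorem hasDerivAt_weighted (c : ℂ) {P P' : ℝ → ℂ} (hP : ∀ t, HasDerivAt P (P' t) t) (x : ℝ) :
    HasDerivAt (weighted c P) (weightedDeriv c P P' x) x := by
  have hw : HasDerivAt (fun x : ℝ => ((1 + x ^ 2 : ℝ) : ℂ)) (2 * x) x := by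
    have := (((hasDerivAt_id x).pow 2).const_add 1).ofReal_comp
    simpa using this
  have hs : ((1 + x ^ 2 : ℝ) : ℂ) ∈ Complex.slitPlane :=
    Complex.ofReal_mem_slitPlane.2 (by positivity)
  have h0 : ((1 + x ^ 2 : ℝ) : ℂ) ≠ 0 := Complex.slitPlane_ne_zero hs
  have h1 : HasDerivAt (fun x : ℝ => ((1 + x ^ 2 : ℝ) : ℂ) ^ (-c))
      (-c * ((1 + x ^ 2 : ℝ) : ℂ) ^ (-c - 1) * 1 * (2 * x)) x :=
    HasDerivAt.comp (h₂ := fun z : ℂ => z ^ (-c)) x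
      ((hasDerivAt_id ((1 + x ^ 2 : ℝ) : ℂ)).cpow_const (c := -c) hs) hw
  have h2 := (hP (arccot x)).scomp x (hasDerivAt_arccot x)
  refine (h1.mul h2).congr_deriv ?_
  simp only [weightedDeriv, Complex.real_smul, Function.comp_apply]
  have h3 : ((1 + x ^ 2 : ℝ) : ℂ) ^ (-c) =
      ((1 + x ^ 2 : ℝ) : ℂ) ^ (-c - 1) * ((1 + x ^ 2 : ℝ) : ℂ) := by
    rw [Complex.cpow_sub _ _ h0, Complex.cpow_one, div_mul_cancel₀ _ h0]
  rw [h3]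
  push_cast at h0 ⊢
  field_simp
  ring

theorem exists_norm_comp_arccot_le {P : ℝ → ℂ} (hP : Continuous P) :
    ∃ M, 0 ≤ M ∧ ∀ x, ‖P (arccot x)‖ ≤ M := by
  obtain ⟨M, hM⟩ := (isCompact_Icc (a := (0 : ℝ)) (b := π)).exists_bound_of_continuousOn
    hP.continuousOn
  have h := fun x => hM _ (Ioo_subset_Icc_self (arccot_mem_Ioo x))
  exact ⟨M, (norm_nonneg _).trans (h 0), h⟩

theorem exists_norm_weightedDeriv_le (c : ℂ) {P P' : ℝ → ℂ} (hP : Continuous P)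
    (hP' : Continuous P') :
    ∃ K, 0 ≤ K ∧ ∀ x, ‖weightedDeriv c P P' x‖ ≤ K * (1 + x ^ 2) ^ (-(c.re + 1 / 2)) := by
  obtain ⟨M, hM0, hM⟩ := exists_norm_comp_arccot_le hP
  obtain ⟨M', hM0', hM'⟩ := exists_norm_comp_arccot_le hP'
  refine ⟨2 * ‖c‖ * M + M', by positivity, fun x => ?_⟩
  have hw : 0 < 1 + x ^ 2 := by positivity
  have hsplit : (1 + x ^ 2) ^ (-(c.re + 1 / 2)) =
      (1 + x ^ 2) ^ (-c.re - 1) * (1 + x ^ 2) ^ (1 / 2 : ℝ) := by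
    rw [← Real.rpow_add hw]; congr 1; ring
  have h1 : 1 ≤ (1 + x ^ 2) ^ (1 / 2 : ℝ) := Real.one_le_rpow (by nlinarith) (by norm_num)
  have h2 : |x| ≤ (1 + x ^ 2) ^ (1 / 2 : ℝ) := by
    rw [← Real.sqrt_eq_rpow]
    exact Real.abs_le_sqrt (by linarith)
  rw [weightedDeriv, norm_mul, Complex.norm_cpow_eq_rpow_re_of_pos hw, hsplit]
  have h3 : ‖-(2 * c * x) * P (arccot x) - P' (arccot x)‖ ≤
      (2 * ‖c‖ * M + M') * (1 + x ^ 2) ^ (1 / 2 : ℝ) := by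
    refine (norm_sub_le _ _).trans ?_
    rw [norm_mul, norm_neg, norm_mul, norm_mul, Complex.norm_real, Real.norm_eq_abs, add_mul]
    have e : ‖(2 : ℂ)‖ = 2 := by simp
    rw [e]
    have h4 : 2 * ‖c‖ * |x| * ‖P (arccot x)‖ ≤ 2 * ‖c‖ * (1 + x ^ 2) ^ (1 / 2 : ℝ) * M := by
      gcongr
      exact hM x
    have h5 := hM' x
    nlinarith
  have e : (-c - 1 : ℂ).re = -c.re - 1 := by simp
  rw [e]
  calc _ ≤ (1 + x ^ 2) ^ (-c.re - 1) * ((2 * ‖c‖ * M + M') * (1 + x ^ 2) ^ (1 / 2 : ℝ)) := by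
        gcongr
    _ = _ := by ring

theorem tendsto_one_add_sq_rpow {p : ℝ} (hp : 0 < p) {l : Filter ℝ}
    (hl : Tendsto (fun x : ℝ => |x|) l atTop) :
    Tendsto (fun x : ℝ => (1 + x ^ 2) ^ (-p)) l (nhds 0) := by
  refine (tendsto_rpow_neg_atTop hp).comp ?_
  refine tendsto_atTop_add_const_left _ _ ?_
  have := (tendsto_pow_atTop (α := ℝ) (n := 2) (by norm_num)).comp hl
  simpa [Function.comp_def] using this

theorem isDecayingC1_weighted {c : ℂ} (hc : 0 < c.re) {P P' : ℝ → ℂ}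
    (hP : ∀ t, HasDerivAt P (P' t) t) (hP' : Continuous P') :
    IsDecayingC1 (weighted c P) (weightedDeriv c P P') := by
  have hPc : Continuous P := continuous_iff_continuousAt.2 fun t => (hP t).continuousAt
  have hcont : Continuous (weightedDeriv c P P') := by
    have h1 := continuous_one_add_sq_cpow (-c - 1)
    have h2 := hPc.comp continuous_arccot
    have h3 := hP'.comp continuous_arccot
    unfold weightedDeriv
    exact h1.mul (((by fun_prop : Continuous fun x : ℝ => -(2 * c * (x : ℂ))).mul h2).sub h3)
  obtain ⟨M, hM0, hM⟩ := exists_norm_comp_arccot_le hPc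
  have hlim : ∀ l : Filter ℝ, Tendsto (fun x : ℝ => |x|) l atTop →
      Tendsto (weighted c P) l (nhds 0) := by
    intro l hl
    refine squeeze_zero_norm (a := fun x => (1 + x ^ 2) ^ (-c.re) * M) (fun x => ?_) ?_
    · rw [norm_weighted]
      gcongr
      exact hM x
    · simpa using (tendsto_one_add_sq_rpow hc hl).mul_const M
  refine ⟨hasDerivAt_weighted c hP, hcont, ?_, hlim _ tendsto_abs_atTop_atTop,
    hlim _ tendsto_abs_atBot_atTop⟩
  obtain ⟨K, hK0, hK⟩ := exists_norm_weightedDeriv_le c hPc hP'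
  have hi : Integrable (fun x : ℝ => (1 + x ^ 2) ^ (-(c.re + 1 / 2))) := by
    have h := integrable_rpow_neg_one_add_norm_sq (E := ℝ) (μ := volume) (r := 2 * c.re + 1)
      (by simp; linarith)
    convert h using 3 with x
    · simp
    · ring
  exact (hi.const_mul K).mono' hcont.aestronglyMeasurable (Filter.Eventually.of_forall hK)

theorem lintegral_lintegral_add_mul_of_symm {φ : ℝ → ℝ≥0∞} (hφ : Measurable φ)
    {ψ : ℝ → ℝ → ℝ≥0∞} (hψ : Measurable (Function.uncurry ψ)) (hs : ∀ x y, ψ x y = ψ y x) :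
    ∫⁻ x, ∫⁻ y, (φ x + φ y) * ψ x y = 2 * ∫⁻ x, ∫⁻ y, φ x * ψ x y := by
  have hm1 : Measurable (Function.uncurry fun x y => φ x * ψ x y) :=
    (hφ.comp measurable_fst).mul hψ
  have hm2 : Measurable (Function.uncurry fun x y => φ y * ψ x y) :=
    (hφ.comp measurable_snd).mul hψ
  have h2 : ∫⁻ x, ∫⁻ y, φ y * ψ x y = ∫⁻ x, ∫⁻ y, φ x * ψ x y := by
    rw [lintegral_lintegral_swap hm2.aemeasurable]
    exact lintegral_congr fun x => lintegral_congr fun y => by rw [hs]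
  calc _ = ∫⁻ x, ((∫⁻ y, φ x * ψ x y) + ∫⁻ y, φ y * ψ x y) := by
        refine lintegral_congr fun x => ?_
        have h3 : Measurable fun y => φ x * ψ x y := hm1.comp measurable_prodMk_left
        rw [← lintegral_add_left h3]
        exact lintegral_congr fun y => add_mul _ _ _
    _ = _ := by
        have h3 : Measurable fun x => ∫⁻ y, φ x * ψ x y := hm1.lintegral_prod_right'
        rw [lintegral_add_left h3, h2, two_mul]

theorem norm_weighted_sub_sq_le {c : ℂ} (hc : c.re = 1 / 2) {P P' : ℝ → ℂ}
    (hP : ∀ t, HasDerivAt P (P' t) t) (hP' : Continuous P') :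
    ∃ K, 0 ≤ K ∧ ∀ x y, ‖weighted c P x - weighted c P y‖ ^ 2 ≤
      K * ((1 + x ^ 2) ^ (-1 : ℝ) + (1 + y ^ 2) ^ (-1 : ℝ)) * min 1 ((x - y) ^ 2) := by
  have hPc : Continuous P := continuous_iff_continuousAt.2 fun t => (hP t).continuousAt
  obtain ⟨M, hM0, hM⟩ := exists_norm_comp_arccot_le hPc
  obtain ⟨K, hK0, hK⟩ := exists_norm_weightedDeriv_le c hPc hP'
  have hf : ∀ x, ‖weighted c P x‖ ^ 2 ≤ M ^ 2 * (1 + x ^ 2) ^ (-1 : ℝ) := by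
    intro x
    have hw : 0 < 1 + x ^ 2 := by positivity
    rw [norm_weighted, mul_pow, ← Real.rpow_natCast, ← Real.rpow_mul hw.le, hc, mul_comm]
    norm_num
    gcongr
    exact hM x
  refine ⟨2 * M ^ 2 + 9 * K ^ 2, by positivity, fun x y => ?_⟩
  have hx : 0 < (1 + x ^ 2) ^ (-1 : ℝ) := by positivity
  have hy : 0 < (1 + y ^ 2) ^ (-1 : ℝ) := by positivity
  rcases le_total ((x - y) ^ 2) 1 with h | h
  · rw [min_eq_right h]
    have hxy : |x - y| ≤ 1 := (sq_le_one_iff_abs_le_one _).1 h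
    have hd : ∀ z ∈ uIcc y x, ‖weightedDeriv c P P' z‖ ≤ 3 * K * (1 + x ^ 2) ^ (-1 : ℝ) := by
      intro z hz
      refine (hK z).trans ?_
      rw [hc]
      norm_num
      rw [Real.rpow_neg_one, Real.rpow_neg_one]
      have hzx : (x - z) ^ 2 ≤ 1 := by
        rw [sq_le_one_iff_abs_le_one]
        refine le_trans ?_ hxy
        rw [abs_sub_comm x z, abs_sub_comm x y]
        exact abs_sub_left_of_mem_uIcc (uIcc_comm y x ▸ hz)
      have h3 : 1 + x ^ 2 ≤ 3 * (1 + z ^ 2) := by nlinarith [sq_nonneg (x - 2 * z)]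
      have h4 : (1 + z ^ 2)⁻¹ ≤ 3 * (1 + x ^ 2)⁻¹ := by
        rw [inv_eq_one_div, inv_eq_one_div, mul_one_div, div_le_div_iff₀ (by positivity)
          (by positivity)]
        linarith
      nlinarith
    have hmvt := (convex_uIcc y x).norm_image_sub_le_of_norm_hasDerivWithin_le
      (fun z _ => (hasDerivAt_weighted c hP z).hasDerivWithinAt) hd left_mem_uIcc right_mem_uIcc
    have hx1 : (1 + x ^ 2) ^ (-1 : ℝ) ≤ 1 := by
      rw [Real.rpow_neg_one]
      exact inv_le_one_of_one_le₀ (by nlinarith)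
    calc _ ≤ (3 * K * (1 + x ^ 2) ^ (-1 : ℝ) * ‖x - y‖) ^ 2 := by gcongr
      _ = 9 * K ^ 2 * ((1 + x ^ 2) ^ (-1 : ℝ)) * (1 + x ^ 2) ^ (-1 : ℝ) * (x - y) ^ 2 := by
          rw [mul_pow, Real.norm_eq_abs, sq_abs]; ring
      _ ≤ 9 * K ^ 2 * ((1 + x ^ 2) ^ (-1 : ℝ)) * 1 * (x - y) ^ 2 := by gcongr
      _ ≤ _ := by
          rw [mul_one]
          gcongr
          · nlinarith [sq_nonneg M]
          · linarith
  · rw [min_eq_left h, mul_one]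
    have h1 : ‖weighted c P x - weighted c P y‖ ^ 2 ≤
        2 * (‖weighted c P x‖ ^ 2 + ‖weighted c P y‖ ^ 2) := by
      have := norm_sub_le (weighted c P x) (weighted c P y)
      nlinarith [sq_nonneg (‖weighted c P x‖ - ‖weighted c P y‖),
        norm_nonneg (weighted c P x - weighted c P y)]
    have h2 : 0 ≤ 9 * K ^ 2 * ((1 + x ^ 2) ^ (-1 : ℝ) + (1 + y ^ 2) ^ (-1 : ℝ)) := by positivity
    nlinarith [hf x, hf y]

theorem gagliardo_weighted_lt_top {a : ℝ} (ha : a ∈ Ioo (0 : ℝ) 1) {c : ℂ} (hc : c.re = 1 / 2)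
    {P P' : ℝ → ℂ} (hP : ∀ t, HasDerivAt P (P' t) t) (hP' : Continuous P') :
    gagliardo a (weighted c P) < ∞ := by
  obtain ⟨K, hK0, hK⟩ := norm_weighted_sub_sq_le hc hP hP'
  set φ : ℝ → ℝ≥0∞ := fun x => ENNReal.ofReal ((1 + x ^ 2) ^ (-1 : ℝ)) with hφ
  set j : ℝ → ℝ≥0∞ := fun t => ENNReal.ofReal (min 1 (t ^ 2) * |t| ^ (-(1 + a))) with hj
  have hφm : Measurable φ := by fun_prop
  have hjm : Measurable j := by fun_prop
  have hψ : Measurable (Function.uncurry fun x y => j (x - y)) :=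
    hjm.comp (measurable_fst.sub measurable_snd)
  have hle : gagliardo a (weighted c P) ≤
      ∫⁻ x, ∫⁻ y, ENNReal.ofReal K * ((φ x + φ y) * j (x - y)) := by
    refine lintegral_mono fun x => lintegral_mono fun y => ?_
    simp only [hφ, hj]
    rw [← ENNReal.ofReal_add (by positivity) (by positivity), ← ENNReal.ofReal_mul (by positivity),
      ← ENNReal.ofReal_mul hK0]
    refine ENNReal.ofReal_le_ofReal ?_
    calc _ ≤ _ := mul_le_mul_of_nonneg_right (hK x y) (by positivity)
      _ = _ := by ring
  refine hle.trans_lt ?_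
  simp_rw [lintegral_const_mul' _ _ ENNReal.ofReal_ne_top]
  rw [lintegral_lintegral_add_mul_of_symm hφm hψ (fun x y => by
    simp only [hj]; rw [abs_sub_comm, show (x - y) ^ 2 = (y - x) ^ 2 by ring])]
  have h1 : ∀ x, ∫⁻ y, φ x * j (x - y) = φ x * ∫⁻ t, j t := by
    intro x
    rw [lintegral_const_mul' _ _ ENNReal.ofReal_ne_top, lintegral_sub_left_eq_self]
  simp_rw [h1]
  rw [lintegral_mul_const _ hφm]
  exact ENNReal.mul_lt_top ENNReal.ofReal_lt_top (ENNReal.mul_lt_top (by simp)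
    (ENNReal.mul_lt_top (lintegral_one_add_sq_rpow_lt_top (by norm_num))
      (lintegral_min_sq_mul_rpow_lt_top ha)))

/-- The energy of `f` with respect to the Hardy weight `|x|^{-a}`. -/
def hardyEnergy (a : ℝ) (f : ℝ → ℂ) : ℝ≥0∞ :=
  ∫⁻ x, ENNReal.ofReal (‖f x‖ ^ 2 * |x| ^ (-a))

theorem hardyEnergy_le_dilation {a : ℝ} {f : ℝ → ℂ} (hf : Continuous f)
    (hI : hardyEnergy a f ≠ ∞) {t : ℝ} (ht : 0 < t) (ht' : t ^ (a - 1) ≤ 1 / 4) :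
    hardyEnergy a f ≤ 4 * ∫⁻ x, ENNReal.ofReal (‖f x - f (x * t)‖ ^ 2 * |x| ^ (-a)) := by
  set I := hardyEnergy a f with hIdef
  set D := ∫⁻ x, ENNReal.ofReal (‖f x - f (x * t)‖ ^ 2 * |x| ^ (-a))
  have hscale : ∫⁻ x, ENNReal.ofReal (‖f (x * t)‖ ^ 2 * |x| ^ (-a)) ≤
      ENNReal.ofReal (1 / 4) * I := by
    have h1 : ∫⁻ x, ENNReal.ofReal (‖f (x * t)‖ ^ 2 * |x| ^ (-a)) =
        ENNReal.ofReal (t ^ (a - 1)) * I := by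
      rw [hIdef, hardyEnergy,
        lintegral_eq_abs_mul_comp_mul (fun x => ENNReal.ofReal (‖f x‖ ^ 2 * |x| ^ (-a))) ht.ne',
        ← mul_assoc, ← ENNReal.ofReal_mul (by positivity),
        ← lintegral_const_mul' _ _ ENNReal.ofReal_ne_top]
      refine lintegral_congr fun x => ?_
      rw [← ENNReal.ofReal_mul (by positivity)]
      congr 1
      rw [abs_mul, abs_of_pos ht, Real.mul_rpow ht.le (abs_nonneg x), mul_comm x t]
      have : t ^ (a - 1) * t * t ^ (-a) = 1 := by
        nth_rewrite 2 [← Real.rpow_one t]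
        rw [← Real.rpow_add ht, ← Real.rpow_add ht]
        norm_num
      linear_combination (-‖f (t * x)‖ ^ 2 * |x| ^ (-a)) * this
    rw [h1]
    gcongr
  have hI2 : I ≤ 2 * D + 2 * (ENNReal.ofReal (1 / 4) * I) := by
    calc I ≤ ∫⁻ x, (2 * ENNReal.ofReal (‖f x - f (x * t)‖ ^ 2 * |x| ^ (-a)) +
          2 * ENNReal.ofReal (‖f (x * t)‖ ^ 2 * |x| ^ (-a))) := by
          refine lintegral_mono fun x => ?_
          rw [← ENNReal.ofReal_ofNat 2, ← ENNReal.ofReal_mul (by positivity),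
            ← ENNReal.ofReal_mul (by positivity), ← ENNReal.ofReal_add (by positivity)
            (by positivity)]
          refine ENNReal.ofReal_le_ofReal ?_
          have h1 : ‖f x‖ ≤ ‖f x - f (x * t)‖ + ‖f (x * t)‖ := by
            simpa using norm_add_le (f x - f (x * t)) (f (x * t))
          have h2 : ‖f x‖ ^ 2 ≤ 2 * ‖f x - f (x * t)‖ ^ 2 + 2 * ‖f (x * t)‖ ^ 2 := by
            nlinarith [sq_nonneg (‖f x - f (x * t)‖ - ‖f (x * t)‖), norm_nonneg (f x)]
          calc _ ≤ _ := mul_le_mul_of_nonneg_right h2 (by positivity)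
            _ = _ := by ring
      _ = 2 * D + 2 * ∫⁻ x, ENNReal.ofReal (‖f (x * t)‖ ^ 2 * |x| ^ (-a)) := by
          rw [lintegral_add_left (by fun_prop), lintegral_const_mul' _ _ (by simp),
            lintegral_const_mul' _ _ (by simp)]
      _ ≤ _ := by gcongr
  rcases eq_or_ne D ∞ with hD | hD
  · rw [hD]; simp
  lift I to ℝ≥0 using hI with i
  lift D to ℝ≥0 using hD with d
  have h4 : ENNReal.ofReal (1 / 4) = ((1 / 4 : ℝ≥0) : ℝ≥0∞) := by
    rw [← ENNReal.ofReal_coe_nnreal]; norm_num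
  rw [h4] at hI2
  norm_cast at hI2 ⊢
  rw [← NNReal.coe_le_coe] at hI2 ⊢
  push_cast at hI2 ⊢
  linarith

theorem exists_hardyEnergy_le {a : ℝ} (ha : a ∈ Ioo (0 : ℝ) 1) :
    ∃ H : ℝ≥0, ∀ f : ℝ → ℂ, Continuous f → hardyEnergy a f ≠ ∞ →
      hardyEnergy a f ≤ H * gagliardo a f := by
  obtain ⟨h0, h1⟩ := ha
  set T : ℝ := 4 ^ (1 / (1 - a)) with hT
  have hT1 : 1 ≤ T := Real.one_le_rpow (by norm_num) (by
    have : 0 < 1 - a := by linarith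
    positivity)
  have hT0 : 0 < T := by linarith
  have hTa : T ^ (a - 1) = 1 / 4 := by
    rw [hT, ← Real.rpow_mul (by norm_num)]
    have : 1 / (1 - a) * (a - 1) = -1 := by
      have : 1 - a ≠ 0 := by linarith
      field_simp
      ring
    rw [this, Real.rpow_neg_one]
    norm_num
  refine ⟨4 * (T ^ (1 + a)).toNNReal, fun f hf hI => ?_⟩
  have hD : ∀ t ∈ Icc T (T + 1), hardyEnergy a f ≤
      4 * ∫⁻ x, ENNReal.ofReal (‖f x - f (x * t)‖ ^ 2 * |x| ^ (-a)) := fun t ht =>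
    hardyEnergy_le_dilation hf hI (by linarith [ht.1])
      (hTa ▸ Real.rpow_le_rpow_of_nonpos hT0 ht.1 (by linarith))
  have hvol : hardyEnergy a f = ∫⁻ _ in Icc T (T + 1), hardyEnergy a f := by simp
  have hm : Measurable (Function.uncurry fun t x : ℝ =>
      ENNReal.ofReal (‖f x - f (x * t)‖ ^ 2 * |x| ^ (-a))) := by
    unfold Function.uncurry
    have := hf.measurable
    fun_prop
  calc hardyEnergy a f
      ≤ ∫⁻ t in Icc T (T + 1), 4 * ∫⁻ x, ENNReal.ofReal (‖f x - f (x * t)‖ ^ 2 * |x| ^ (-a)) := by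
        rw [hvol]
        exact setLIntegral_mono' measurableSet_Icc hD
    _ = 4 * ∫⁻ x, ∫⁻ t in Icc T (T + 1), ENNReal.ofReal (‖f x - f (x * t)‖ ^ 2 * |x| ^ (-a)) := by
        rw [lintegral_const_mul' _ _ (by simp), lintegral_lintegral_swap hm.aemeasurable]
    _ ≤ 4 * ∫⁻ x, ENNReal.ofReal (T ^ (1 + a)) *
          ∫⁻ y, ENNReal.ofReal (‖f x - f y‖ ^ 2 * |x - y| ^ (-(1 + a))) := by
        gcongr 4 * ?_
        refine lintegral_mono_ae ?_
        filter_upwards [Measure.ae_ne volume (0 : ℝ)] with x hx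
        rw [lintegral_eq_abs_mul_comp_mul _ hx, ← mul_assoc,
          ← ENNReal.ofReal_mul (by positivity), ← lintegral_const_mul' _ _ ENNReal.ofReal_ne_top]
        refine (setLIntegral_mono' measurableSet_Icc fun t ht => ?_).trans
          (setLIntegral_le_lintegral _ _)
        rw [← ENNReal.ofReal_mul (by positivity)]
        refine ENNReal.ofReal_le_ofReal ?_
        have hx0 : 0 < |x| := abs_pos.2 hx
        rcases eq_or_lt_of_le (hT1.trans ht.1) with h | h
        · rw [← h]; simp
        have hpos : 0 < |x - x * t| := by
          rw [abs_pos, sub_ne_zero]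
          intro h2
          exact h.ne (mul_left_cancel₀ hx (by rw [mul_one]; exact h2))
        have hle : |x - x * t| ≤ T * |x| := by
          rw [show x - x * t = x * (1 - t) by ring, abs_mul, mul_comm T]
          gcongr
          rw [abs_le]
          constructor <;> linarith [ht.1, ht.2]
        have h3 : (T * |x|) ^ (-(1 + a)) ≤ |x - x * t| ^ (-(1 + a)) :=
          Real.rpow_le_rpow_of_nonpos hpos hle (by linarith)
        have h4 : |x| ^ (-a) = T ^ (1 + a) * |x| * (T * |x|) ^ (-(1 + a)) := by
          rw [Real.mul_rpow hT0.le hx0.le, Real.rpow_neg hT0.le]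
          nth_rewrite 2 [← Real.rpow_one |x|]
          have h5 : |x| ^ (1 : ℝ) * |x| ^ (-(1 + a)) = |x| ^ (-a) := by
            rw [← Real.rpow_add hx0]; congr 1; ring
          have h6 : T ^ (1 + a) ≠ 0 := by positivity
          field_simp
          linear_combination -h5
        rw [h4]
        calc _ ≤ ‖f x - f (x * t)‖ ^ 2 * (T ^ (1 + a) * |x| * |x - x * t| ^ (-(1 + a))) := by
              gcongr
          _ = _ := by ring
    _ = _ := by
        rw [lintegral_const_mul' _ _ ENNReal.ofReal_ne_top, ← mul_assoc]
        rfl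

theorem hardyEnergy_weighted_ne_top {a : ℝ} (ha : a ∈ Ioo (0 : ℝ) 1) {c : ℂ}
    (hc : c.re = (1 - a) / 2) {P : ℝ → ℂ} (hP : Continuous P) :
    hardyEnergy a (weighted c P) ≠ ∞ := by
  obtain ⟨h0, h1⟩ := ha
  obtain ⟨M, hM0, hM⟩ := exists_norm_comp_arccot_le hP
  have hf : ∀ x, ‖weighted c P x‖ ^ 2 ≤ M ^ 2 * (1 + x ^ 2) ^ (-(1 - a)) := by
    intro x
    have hw : 0 < 1 + x ^ 2 := by positivity
    rw [norm_weighted, mul_pow, ← Real.rpow_natCast, ← Real.rpow_mul hw.le, hc, mul_comm]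
    have : -((1 - a) / 2) * ((2 : ℕ) : ℝ) = -(1 - a) := by push_cast; ring
    rw [this]
    gcongr
    exact hM x
  set A : ℝ≥0∞ := ∫⁻ x, (Icc (-1 : ℝ) 1).indicator (fun x => ENNReal.ofReal (|x| ^ (-a))) x
  set B : ℝ≥0∞ := ∫⁻ x : ℝ, ENNReal.ofReal ((1 + x ^ 2) ^ (-(1 - a / 2)))
  have hA : A < ∞ := by
    simp only [A]
    rw [lintegral_indicator measurableSet_Icc]
    exact lintegral_abs_rpow_lt_top h1
  have hB : B < ∞ := lintegral_one_add_sq_rpow_lt_top (by linarith)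
  have hle : hardyEnergy a (weighted c P) ≤
      ENNReal.ofReal (M ^ 2) * (A + ENNReal.ofReal 2 * B) := by
    simp only [A, B]
    rw [hardyEnergy, ← lintegral_const_mul' _ _ ENNReal.ofReal_ne_top,
      ← lintegral_add_right _ (by fun_prop), ← lintegral_const_mul' _ _ ENNReal.ofReal_ne_top]
    refine lintegral_mono fun x => ?_
    have hw : 0 < 1 + x ^ 2 := by positivity
    by_cases hx : x ∈ Icc (-1 : ℝ) 1
    · rw [indicator_of_mem hx]
      refine le_trans ?_ (mul_le_mul_right (le_add_right le_rfl) _)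
      rw [← ENNReal.ofReal_mul (by positivity)]
      refine ENNReal.ofReal_le_ofReal ?_
      refine mul_le_mul_of_nonneg_right ?_ (by positivity)
      refine (hf x).trans (mul_le_of_le_one_right (by positivity) ?_)
      exact Real.rpow_le_one_of_one_le_of_nonpos (by nlinarith) (by linarith)
    · rw [indicator_of_notMem hx, zero_add, ← ENNReal.ofReal_mul (by norm_num),
        ← ENNReal.ofReal_mul (by positivity)]
      refine ENNReal.ofReal_le_ofReal ?_
      have hx1 : 1 ≤ |x| := by
        by_contra! h
        exact hx (abs_le.1 h.le)
      calc _ ≤ (M ^ 2 * (1 + x ^ 2) ^ (-(1 - a))) * (2 * (1 + x ^ 2) ^ (-(a / 2))) :=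
            mul_le_mul (hf x) (abs_rpow_neg_le h0.le (by linarith) hx1) (by positivity)
              (by positivity)
        _ = M ^ 2 * (2 * ((1 + x ^ 2) ^ (-(1 - a)) * (1 + x ^ 2) ^ (-(a / 2)))) := by ring
        _ = _ := by
            rw [← Real.rpow_add hw]
            congr 3
            ring
  exact (hle.trans_lt (ENNReal.mul_lt_top ENNReal.ofReal_lt_top (ENNReal.add_lt_top.2
    ⟨hA, ENNReal.mul_lt_top ENNReal.ofReal_lt_top hB⟩))).ne

theorem mul_mul_norm_sub_sq_le {m n : ℝ} (hm : 0 < m) (hmn : m ≤ n) (A B : ℂ) :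
    m * n * ‖A - B‖ ^ 2 ≤ 2 * ‖m * A - n * B‖ ^ 2 + 2 * ((n - m) ^ 2 * (m / n)) * ‖A‖ ^ 2 := by
  have hn : 0 < n := hm.trans_le hmn
  have hid : m * n * ‖A - B‖ ^ 2 =
      ‖m * A - n * B‖ ^ 2 + (n - m) * (m * ‖A‖ ^ 2 - n * ‖B‖ ^ 2) := by
    simp only [Complex.sq_norm, Complex.normSq_apply, Complex.sub_re, Complex.sub_im,
      Complex.mul_re, Complex.mul_im, Complex.ofReal_re, Complex.ofReal_im]
    ring
  set d := ‖m * A - n * B‖ with hd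
  have htri : m * ‖A‖ - n * ‖B‖ ≤ d := by
    have h := norm_sub_norm_le (m * A) (n * B)
    rwa [norm_mul, norm_mul, Complex.norm_real, Complex.norm_real, Real.norm_of_nonneg hm.le,
      Real.norm_of_nonneg hn.le] at h
  have hd0 : 0 ≤ d := norm_nonneg _
  have hp : 0 ≤ m * ‖A‖ := by positivity
  have hq : 0 ≤ n * ‖B‖ := by positivity
  have key : (n - m) * (n * (m * ‖A‖) ^ 2 - m * (n * ‖B‖) ^ 2) ≤
      m * n * d ^ 2 + 2 * (n - m) ^ 2 * (m * ‖A‖) ^ 2 := by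
    generalize m * ‖A‖ = p at *
    generalize n * ‖B‖ = q at *
    have hnm : 0 ≤ n - m := by linarith
    have hmn0 : 0 ≤ m * n * d ^ 2 := by positivity
    rcases le_total p q with h | h
    · have h1 : p ^ 2 ≤ q ^ 2 := by gcongr
      have h2 : n * p ^ 2 - m * q ^ 2 ≤ (n - m) * p ^ 2 := by nlinarith
      have h3 := mul_le_mul_of_nonneg_left h2 hnm
      nlinarith [sq_nonneg ((n - m) * p)]
    · have h1 : p ^ 2 - q ^ 2 ≤ 2 * p * (p - q) := by nlinarith [sq_nonneg (p - q)]
      have h2 : n * p ^ 2 - m * q ^ 2 ≤ (n - m) * p ^ 2 + m * (2 * p * (p - q)) := by nlinarith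
      have h3 := mul_le_mul_of_nonneg_left h2 hnm
      have h4 : m ^ 2 * (p - q) ^ 2 ≤ m * n * d ^ 2 := by
        have h5 : (p - q) ^ 2 ≤ d ^ 2 := by
          have : 0 ≤ p - q := by linarith
          gcongr
        have h6 : m ^ 2 ≤ m * n := by nlinarith
        exact mul_le_mul h6 h5 (sq_nonneg _) (by positivity)
      nlinarith [sq_nonneg ((n - m) * p - m * (p - q))]
  rw [hid]
  have h1 : (n - m) * (m * ‖A‖ ^ 2 - n * ‖B‖ ^ 2) =
      (n - m) * (n * (m * ‖A‖) ^ 2 - m * (n * ‖B‖) ^ 2) / (m * n) := by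
    field_simp
  have h2 : (n - m) * (n * (m * ‖A‖) ^ 2 - m * (n * ‖B‖) ^ 2) / (m * n) ≤
      d ^ 2 + 2 * ((n - m) ^ 2 * (m / n)) * ‖A‖ ^ 2 := by
    rw [div_le_iff₀ (by positivity)]
    refine key.trans_eq ?_
    field_simp
  linarith

/-- The profile of the error kernel arising when the weight is commuted past a difference. -/
def errorProfile (a t : ℝ) : ℝ :=
  4 * min 1 ((1 - t) ^ 2) + (Icc (-(1 / 2)) (1 / 2)).indicator (fun t => |t| ^ (-(1 - a))) t

theorem errorProfile_nonneg (a t : ℝ) : 0 ≤ errorProfile a t := by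
  have h : 0 ≤ (Icc (-(1 / 2) : ℝ) (1 / 2)).indicator (fun t => |t| ^ (-(1 - a))) t :=
    indicator_nonneg (fun t _ => by positivity) t
  unfold errorProfile
  positivity

theorem measurable_errorProfile (a : ℝ) : Measurable (errorProfile a) := by
  have h : Measurable (fun t : ℝ => |t| ^ (-(1 - a))) := by fun_prop
  exact (by fun_prop : Measurable fun t : ℝ => 4 * min 1 ((1 - t) ^ 2)).add
    (h.indicator measurableSet_Icc)

theorem lintegral_errorProfile_lt_top {a : ℝ} (ha : a ∈ Ioo (0 : ℝ) 1) :
    ∫⁻ t, ENNReal.ofReal (errorProfile a t * |1 - t| ^ (-(1 + a))) < ∞ := by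
  obtain ⟨h0, h1⟩ := ha
  set j : ℝ → ℝ≥0∞ := fun t => ENNReal.ofReal (min 1 (t ^ 2) * |t| ^ (-(1 + a))) with hj
  set A : ℝ≥0∞ :=
    ∫⁻ x, (Icc (-1 : ℝ) 1).indicator (fun x => ENNReal.ofReal (|x| ^ (-(1 - a)))) x with hA
  have hle : ∫⁻ t, ENNReal.ofReal (errorProfile a t * |1 - t| ^ (-(1 + a))) ≤
      ENNReal.ofReal 4 * (∫⁻ t, j (1 - t)) + ENNReal.ofReal (2 ^ (1 + a)) * A := by
    rw [hA, ← lintegral_const_mul' _ _ ENNReal.ofReal_ne_top,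
      ← lintegral_const_mul' _ _ ENNReal.ofReal_ne_top,
      ← lintegral_add_left (by fun_prop)]
    refine lintegral_mono fun t => ?_
    simp only [hj]
    rw [errorProfile, add_mul, ENNReal.ofReal_add (by positivity)
      (mul_nonneg (indicator_nonneg (fun t _ => by positivity) t) (by positivity)), mul_assoc,
      ENNReal.ofReal_mul (by norm_num)]
    gcongr
    by_cases ht : t ∈ Icc (-(1 / 2) : ℝ) (1 / 2)
    · rw [indicator_of_mem ht, 
        indicator_of_mem (show t ∈ Icc (-1 : ℝ) 1 from ⟨by linarith [ht.1], by linarith [ht.2]⟩),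
        ← ENNReal.ofReal_mul (by positivity), mul_comm]
      refine ENNReal.ofReal_le_ofReal (mul_le_mul_of_nonneg_right ?_ (by positivity))
      have h2 : (2 : ℝ) ^ (1 + a) = (1 / 2) ^ (-(1 + a)) := by
        rw [one_div, Real.inv_rpow (by norm_num), Real.rpow_neg (by norm_num), inv_inv]
      rw [h2]
      refine Real.rpow_le_rpow_of_nonpos (by norm_num) ?_ (by linarith)
      rw [abs_of_nonneg] <;> linarith [ht.1, ht.2]
    · rw [indicator_of_notMem ht, zero_mul, ENNReal.ofReal_zero]
      exact zero_le
  refine hle.trans_lt ?_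
  rw [lintegral_sub_left_eq_self j 1, hA, lintegral_indicator measurableSet_Icc]
  exact ENNReal.add_lt_top.2 ⟨ENNReal.mul_lt_top ENNReal.ofReal_lt_top
    (lintegral_min_sq_mul_rpow_lt_top ⟨h0, h1⟩),
    ENNReal.mul_lt_top ENNReal.ofReal_lt_top (lintegral_abs_rpow_lt_top (by linarith))⟩

theorem weight_error_le {a : ℝ} (ha : a ∈ Ioo (0 : ℝ) 1) {x y : ℝ} (hy : y ≠ 0)
    (hyx : |y| ≤ |x|) {m n : ℝ} (hm : m = (1 + x ^ 2) ^ (-((1 - a) / 2)))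
    (hn : n = (1 + y ^ 2) ^ (-((1 - a) / 2))) :
    (n - m) ^ 2 * (m / n) ≤ m ^ 2 * errorProfile a (y / x) := by
  obtain ⟨h0, h1⟩ := ha
  have hx : x ≠ 0 := abs_pos.1 ((abs_pos.2 hy).trans_le hyx)
  have hm0 : 0 < m := hm ▸ by positivity
  have hn0 : 0 < n := hn ▸ by positivity
  have hyx2 : y ^ 2 ≤ x ^ 2 := sq_le_sq.2 hyx
  set t := y / x with ht
  have ht0 : 0 < |t| := abs_pos.2 (div_ne_zero hy hx)
  have ht1 : |t| ≤ 1 := by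
    rw [ht, abs_div]
    exact div_le_one_of_le₀ hyx (abs_nonneg _)
  have hmn : m ≤ n := by
    rw [hm, hn]
    exact Real.rpow_le_rpow_of_nonpos (by positivity) (by linarith) (by linarith)
  obtain ⟨r, hr⟩ : ∃ r, r = n / m := ⟨_, rfl⟩
  have hr1 : 1 ≤ r := by rw [hr, one_le_div hm0]; exact hmn
  have hrt : r ≤ |t| ^ (-(1 - a)) := by
    have e1 : r = ((1 + x ^ 2) / (1 + y ^ 2)) ^ ((1 - a) / 2) := by
      rw [hr, hm, hn, Real.rpow_neg (by positivity), Real.rpow_neg (by positivity),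
        Real.div_rpow (by positivity) (by positivity), inv_div_inv]
    have e2 : |t| ^ (-(1 - a)) = (x ^ 2 / y ^ 2) ^ ((1 - a) / 2) := by
      rw [← div_pow, ← sq_abs, ← Real.rpow_natCast, ← Real.rpow_mul (abs_nonneg _),
        show x / y = t⁻¹ by rw [ht, inv_div], abs_inv, Real.inv_rpow ht0.le,
        Real.rpow_neg ht0.le]
      congr 2
      push_cast
      ring
    rw [e1, e2]
    refine Real.rpow_le_rpow (by positivity) ?_ (by linarith)
    rw [div_le_div_iff₀ (by positivity) (by positivity)]
    nlinarith
  have hE : (n - m) ^ 2 * (m / n) = m ^ 2 * ((r - 1) ^ 2 / r) := by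
    rw [hr]
    field_simp
  rw [hE]
  gcongr
  have hr0 : 0 < r := by linarith
  rw [errorProfile, div_le_iff₀ hr0]
  by_cases hmem : t ∈ Icc (-(1 / 2) : ℝ) (1 / 2)
  · rw [indicator_of_mem hmem]
    have h2 : 0 ≤ 4 * min 1 ((1 - t) ^ 2) := by positivity
    nlinarith
  · rw [indicator_of_notMem hmem, add_zero]
    have ht2 : 1 / 2 < |t| := by
      by_contra! h
      exact hmem (abs_le.1 h)
    have hrt' : r ≤ |t|⁻¹ := by
      refine hrt.trans ?_
      rw [← Real.rpow_neg_one]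
      exact Real.rpow_le_rpow_of_exponent_ge ht0 ht1 (by linarith)
    have h2 : |t|⁻¹ - 1 ≤ 2 * (1 - |t|) := by
      rw [sub_le_iff_le_add, inv_le_iff_one_le_mul₀ ht0]
      nlinarith
    have h3 : 1 - |t| ≤ |1 - t| := by
      have := abs_sub_abs_le_abs_sub 1 t
      simpa using this
    have h4 : (r - 1) ^ 2 ≤ 4 * min 1 ((1 - t) ^ 2) := by
      rw [mul_min_of_nonneg _ _ (by norm_num)]
      refine le_min ?_ ?_
      · nlinarith
      · rw [← sq_abs (1 - t)]
        nlinarith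
    nlinarith [sq_nonneg (r - 1)]

/-- The energy `∬ ‖P α - P β‖² |sin (α - β)|^{-(1+a)}` over a period, written in the line
coordinates `α = arccot x`, `β = arccot y`. -/
def conformalEnergy (a : ℝ) (P : ℝ → ℂ) : ℝ≥0∞ :=
  ∫⁻ x, ∫⁻ y, ENNReal.ofReal (((1 + x ^ 2) ^ (-((1 - a) / 2)) * (1 + y ^ 2) ^ (-((1 - a) / 2))) *
    ‖P (arccot x) - P (arccot y)‖ ^ 2 * |x - y| ^ (-(1 + a)))

theorem weighted_ofReal (p : ℝ) (P : ℝ → ℂ) (x : ℝ) :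
    weighted (p : ℂ) P x = (((1 + x ^ 2) ^ (-p) : ℝ) : ℂ) * P (arccot x) := by
  rw [weighted, Complex.ofReal_cpow (by positivity), Complex.ofReal_neg]

theorem conformal_integrand_le {a : ℝ} (ha : a ∈ Ioo (0 : ℝ) 1) (P : ℝ → ℂ) {x y : ℝ}
    (hx : x ≠ 0) (hy : y ≠ 0) :
    ((1 + x ^ 2) ^ (-((1 - a) / 2)) * (1 + y ^ 2) ^ (-((1 - a) / 2))) *
        ‖P (arccot x) - P (arccot y)‖ ^ 2 ≤
      2 * ‖weighted ((1 - a) / 2 : ℝ) P x - weighted ((1 - a) / 2 : ℝ) P y‖ ^ 2 +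
        (2 * (‖weighted ((1 - a) / 2 : ℝ) P x‖ ^ 2 * errorProfile a (y / x)) +
          2 * (‖weighted ((1 - a) / 2 : ℝ) P y‖ ^ 2 * errorProfile a (x / y))) := by
  wlog hyx : |y| ≤ |x| generalizing x y
  · have h := this hy hx (le_of_not_ge hyx)
    rw [norm_sub_rev, norm_sub_rev (weighted _ P x)]
    linarith
  have h1 := errorProfile_nonneg a (x / y)
  obtain ⟨m, hm⟩ : ∃ m, m = (1 + x ^ 2) ^ (-((1 - a) / 2)) := ⟨_, rfl⟩
  obtain ⟨n, hn⟩ : ∃ n, n = (1 + y ^ 2) ^ (-((1 - a) / 2)) := ⟨_, rfl⟩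
  have herr := weight_error_le ha hy hyx hm hn
  have hm0 : 0 < m := hm ▸ by positivity
  have hmn : m ≤ n := by
    rw [hm, hn]
    have := sq_le_sq.2 hyx
    exact Real.rpow_le_rpow_of_nonpos (by positivity) (by linarith) (by linarith [ha.2])
  have h2 := mul_mul_norm_sub_sq_le hm0 hmn (P (arccot x)) (P (arccot y))
  have h3 := mul_le_mul_of_nonneg_right herr (sq_nonneg ‖P (arccot x)‖)
  simp only [weighted_ofReal, ← hm, ← hn]
  rw [norm_mul (m : ℂ), Complex.norm_real, Real.norm_of_nonneg hm0.le]
  have h4 : 0 ≤ 2 * (‖(n : ℂ) * P (arccot y)‖ ^ 2 * errorProfile a (x / y)) := by positivity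
  nlinarith

theorem lintegral_lintegral_add {φ ψ : ℝ → ℝ → ℝ≥0∞} (hφ : Measurable (Function.uncurry φ)) :
    ∫⁻ x, ∫⁻ y, (φ x y + ψ x y) = (∫⁻ x, ∫⁻ y, φ x y) + ∫⁻ x, ∫⁻ y, ψ x y := by
  have h1 : ∀ x, Measurable (φ x) := fun x => hφ.comp measurable_prodMk_left
  have h2 : Measurable fun x => ∫⁻ y, φ x y := hφ.lintegral_prod_right'
  rw [← lintegral_add_left h2]
  exact lintegral_congr fun x => lintegral_add_left (h1 x) _

theorem lintegral_lintegral_const_mul {c : ℝ≥0∞} (hc : c ≠ ∞) (φ : ℝ → ℝ → ℝ≥0∞) :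
    ∫⁻ x, ∫⁻ y, c * φ x y = c * ∫⁻ x, ∫⁻ y, φ x y := by
  rw [← lintegral_const_mul' _ _ hc]
  exact lintegral_congr fun x => lintegral_const_mul' _ _ hc

/-- The kernel comparing a weighted difference with the Hardy energy. -/
def errorKernel (a : ℝ) (f : ℝ → ℂ) (x y : ℝ) : ℝ≥0∞ :=
  ENNReal.ofReal (‖f x‖ ^ 2 * errorProfile a (y / x) * |x - y| ^ (-(1 + a)))

theorem measurable_errorKernel (a : ℝ) {f : ℝ → ℂ} (hf : Measurable f) :
    Measurable (Function.uncurry (errorKernel a f)) := by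
  have hq := measurable_errorProfile a
  simp only [errorKernel, Function.uncurry_def]
  fun_prop

theorem lintegral_errorKernel {a : ℝ} (ha : a ∈ Ioo (0 : ℝ) 1) (f : ℝ → ℂ) :
    ∫⁻ x, ∫⁻ y, errorKernel a f x y =
      (∫⁻ t, ENNReal.ofReal (errorProfile a t * |1 - t| ^ (-(1 + a)))) * hardyEnergy a f := by
  rw [hardyEnergy, ← lintegral_const_mul' _ _ (lintegral_errorProfile_lt_top ha).ne]
  refine lintegral_congr_ae ?_
  filter_upwards [Measure.ae_ne volume (0 : ℝ)] with x hx
  have hx0 : 0 < |x| := abs_pos.2 hx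
  rw [lintegral_eq_abs_mul_comp_mul _ hx, mul_comm (lintegral _ _),
    ← lintegral_const_mul' _ _ ENNReal.ofReal_ne_top,
    ← lintegral_const_mul' _ _ ENNReal.ofReal_ne_top]
  refine lintegral_congr fun t => ?_
  rw [errorKernel, ← ENNReal.ofReal_mul (by positivity), ← ENNReal.ofReal_mul (by positivity),
    mul_div_cancel_left₀ _ hx, show x - x * t = x * (1 - t) by ring, abs_mul,
    Real.mul_rpow hx0.le (abs_nonneg _)]
  congr 1
  have h5 : |x| * |x| ^ (-(1 + a)) = |x| ^ (-a) := by
    nth_rewrite 1 [← Real.rpow_one |x|]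
    rw [← Real.rpow_add hx0]
    congr 1
    ring
  rw [← h5]
  ring

theorem conformal_integrand_ofReal_le {a : ℝ} (ha : a ∈ Ioo (0 : ℝ) 1) (P : ℝ → ℂ) {x y : ℝ}
    (hx : x ≠ 0) (hy : y ≠ 0) :
    ENNReal.ofReal (((1 + x ^ 2) ^ (-((1 - a) / 2)) * (1 + y ^ 2) ^ (-((1 - a) / 2))) *
        ‖P (arccot x) - P (arccot y)‖ ^ 2 * |x - y| ^ (-(1 + a))) ≤
      2 * ENNReal.ofReal (‖weighted ((1 - a) / 2 : ℝ) P x - weighted ((1 - a) / 2 : ℝ) P y‖ ^ 2 *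
        |x - y| ^ (-(1 + a))) +
        2 * (errorKernel a (weighted ((1 - a) / 2 : ℝ) P) x y +
          errorKernel a (weighted ((1 - a) / 2 : ℝ) P) y x) := by
  have hq1 := errorProfile_nonneg a (y / x)
  have hq2 := errorProfile_nonneg a (x / y)
  simp only [errorKernel]
  rw [← ENNReal.ofReal_add (by positivity) (by positivity), ← ENNReal.ofReal_ofNat 2,
    ← ENNReal.ofReal_mul (by positivity), ← ENNReal.ofReal_mul (by positivity),
    ← ENNReal.ofReal_add (by positivity) (by positivity), abs_sub_comm y x]
  refine ENNReal.ofReal_le_ofReal ?_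
  calc _ ≤ _ := mul_le_mul_of_nonneg_right (conformal_integrand_le ha P hx hy) (by positivity)
    _ = _ := by ring

theorem lintegral_gagliardo_add_errorKernel {a : ℝ} (ha : a ∈ Ioo (0 : ℝ) 1) {f : ℝ → ℂ}
    (hf : Continuous f) :
    ∫⁻ x, ∫⁻ y, (2 * ENNReal.ofReal (‖f x - f y‖ ^ 2 * |x - y| ^ (-(1 + a))) +
        2 * (errorKernel a f x y + errorKernel a f y x)) =
      2 * gagliardo a f + 4 * (∫⁻ t, ENNReal.ofReal (errorProfile a t * |1 - t| ^ (-(1 + a)))) *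
        hardyEnergy a f := by
  have hNm := measurable_errorKernel a hf.measurable
  have hq := measurable_errorProfile a
  have hfm := hf.measurable
  have hNm' : Measurable (Function.uncurry fun x y => errorKernel a f y x) := by
    simp only [errorKernel, Function.uncurry_def]
    fun_prop
  have hkm : Measurable (Function.uncurry fun x y =>
      2 * ENNReal.ofReal (‖f x - f y‖ ^ 2 * |x - y| ^ (-(1 + a)))) := by
    simp only [Function.uncurry_def]
    fun_prop
  rw [lintegral_lintegral_add hkm, lintegral_lintegral_const_mul (by simp),
    lintegral_lintegral_const_mul (by simp), lintegral_lintegral_add hNm,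
    lintegral_lintegral_swap hNm'.aemeasurable, lintegral_errorKernel ha, gagliardo]
  ring

theorem exists_conformalEnergy_le {a : ℝ} (ha : a ∈ Ioo (0 : ℝ) 1) :
    ∃ C : ℝ≥0, ∀ P : ℝ → ℂ, Continuous P →
      conformalEnergy a P ≤ 2 * gagliardo a (weighted ((1 - a) / 2 : ℝ) P) +
        C * hardyEnergy a (weighted ((1 - a) / 2 : ℝ) P) := by
  have hQ := (lintegral_errorProfile_lt_top ha).ne
  refine ⟨4 * (∫⁻ t, ENNReal.ofReal (errorProfile a t * |1 - t| ^ (-(1 + a)))).toNNReal,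
    fun P hP => ?_⟩
  have hfc : Continuous (weighted ((1 - a) / 2 : ℝ) P) :=
    (continuous_one_add_sq_cpow _).mul (hP.comp continuous_arccot)
  have h := lintegral_gagliardo_add_errorKernel ha hfc
  rw [ENNReal.coe_mul, ENNReal.coe_toNNReal hQ, ENNReal.coe_ofNat, ← h]
  refine lintegral_mono_ae ?_
  filter_upwards [Measure.ae_ne volume (0 : ℝ)] with x hx
  refine lintegral_mono_ae ?_
  filter_upwards [Measure.ae_ne volume (0 : ℝ)] with y hy
  exact conformal_integrand_ofReal_le ha P hx hy

theorem setLIntegral_Ioc_eq_of_periodic {φ : ℝ → ℝ≥0∞} {T : ℝ} (hT : 0 < T)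
    (hφ : Function.Periodic φ T) (s t : ℝ) :
    ∫⁻ x in Ioc s (s + T), φ x = ∫⁻ x in Ioc t (t + T), φ x :=
  (isAddFundamentalDomain_Ioc hT s).setLIntegral_eq (isAddFundamentalDomain_Ioc hT t) φ
    fun g x => by
      obtain ⟨n, hn⟩ := AddSubgroup.mem_zmultiples_iff.1 g.2
      rw [AddSubgroup.vadd_def, vadd_eq_add, ← hn, add_comm]
      exact hφ.zsmul n x

theorem setLIntegral_Ioo_comp_sub {φ : ℝ → ℝ≥0∞} (hφ : Function.Periodic φ π) (θ : ℝ) :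
    ∫⁻ t in Ioo 0 π, φ (t - θ) = ∫⁻ t in Ioo 0 π, φ t := by
  rw [setLIntegral_congr Ioo_ae_eq_Ioc, setLIntegral_congr (f := φ) Ioo_ae_eq_Ioc]
  have h := setLIntegral_Ioc_eq_of_periodic pi_pos hφ (-θ) 0
  rw [zero_add] at h
  rw [← h, ← lintegral_indicator measurableSet_Ioc, ← lintegral_indicator measurableSet_Ioc,
    ← lintegral_sub_right_eq_self ((Ioc (-θ) (-θ + π)).indicator φ) θ]
  refine lintegral_congr fun t => ?_
  simp only [indicator, mem_Ioc]
  congr 1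
  simp only [eq_iff_iff]
  constructor <;> rintro ⟨h1, h2⟩ <;> constructor <;> linarith

theorem setLIntegral_Ioc_comp_sub_left {φ : ℝ → ℝ≥0∞} (hφ : Function.Periodic φ π) (α : ℝ) :
    ∫⁻ θ in Ioc 0 (2 * π), φ (α - θ) = 2 * ∫⁻ t in Ioo 0 π, φ t := by
  have hpi := pi_pos
  have h1 : ∫⁻ θ in Ioc 0 (2 * π), φ (α - θ) = ∫⁻ s in Ico (α - 2 * π) α, φ s := by
    rw [← lintegral_indicator measurableSet_Ioc, ← lintegral_indicator measurableSet_Ico,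
      ← lintegral_sub_left_eq_self ((Ico (α - 2 * π) α).indicator φ) α]
    refine lintegral_congr fun t => ?_
    simp only [indicator, mem_Ioc, mem_Ico]
    congr 1
    simp only [eq_iff_iff]
    constructor <;> rintro ⟨h1, h2⟩ <;> constructor <;> linarith
  have h2 := setLIntegral_Ioc_eq_of_periodic pi_pos hφ (α - 2 * π) 0
  have h3 := setLIntegral_Ioc_eq_of_periodic pi_pos hφ (α - π) 0
  rw [zero_add] at h2 h3
  rw [show α - 2 * π + π = α - π by ring] at h2
  rw [sub_add_cancel] at h3
  rw [h1, setLIntegral_congr Ico_ae_eq_Ioc,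
    ← Ioc_union_Ioc_eq_Ioc (b := α - π) (by linarith) (by linarith),
    lintegral_union measurableSet_Ioc (Ioc_disjoint_Ioc_of_le le_rfl), h2, h3, two_mul,
    setLIntegral_congr (f := φ) Ioo_ae_eq_Ioc]

theorem conformalEnergy_eq (a : ℝ) (P : ℝ → ℂ) :
    conformalEnergy a P = ∫⁻ α in Ioo 0 π, ∫⁻ β in Ioo 0 π,
      ENNReal.ofReal (‖P α - P β‖ ^ 2 * |Real.sin (α - β)| ^ (-(1 + a))) := by
  rw [lintegral_Ioo_zero_pi]
  refine lintegral_congr fun x => ?_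
  rw [lintegral_Ioo_zero_pi, ← lintegral_const_mul' _ _ ENNReal.ofReal_ne_top]
  refine lintegral_congr fun y => ?_
  have hx : 0 < 1 + x ^ 2 := by positivity
  have hy : 0 < 1 + y ^ 2 := by positivity
  rw [← ENNReal.ofReal_mul (by positivity), ← ENNReal.ofReal_mul (by positivity),
    abs_sin_arccot_sub, Real.mul_rpow (abs_nonneg _) (by positivity),
    ← Real.rpow_mul (by positivity), Real.mul_rpow hx.le hy.le]
  congr 1
  have e : ∀ w : ℝ, 0 < w → w ^ (-((1 - a) / 2)) = w⁻¹ * w ^ (-(1 / 2) * -(1 + a)) := by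
    intro w hw
    rw [← Real.rpow_neg_one, ← Real.rpow_add hw]
    congr 1
    ring
  rw [e _ hx, e _ hy]
  ring

theorem conformalEnergy_comp_sub (a : ℝ) {g : ℝ → ℂ} (hg : Function.Periodic g π) (θ : ℝ) :
    conformalEnergy a (fun t => g (t - θ)) = conformalEnergy a g := by
  have hs : ∀ α β : ℝ, |Real.sin (α + π - β)| = |Real.sin (α - β)| := fun α β => by
    rw [show α + π - β = α - β + π by ring, Real.sin_add_pi, abs_neg]
  have hs' : ∀ α β : ℝ, |Real.sin (α - (β + π))| = |Real.sin (α - β)| := fun α β => by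
    rw [show α - (β + π) = α - β - π by ring, Real.sin_sub_pi, abs_neg]
  rw [conformalEnergy_eq, conformalEnergy_eq, ← setLIntegral_Ioo_comp_sub
    (φ := fun α => ∫⁻ β in Ioo 0 π,
      ENNReal.ofReal (‖g α - g β‖ ^ 2 * |Real.sin (α - β)| ^ (-(1 + a))))
    (fun α => by simp only [hg α, hs]) θ]
  refine lintegral_congr fun α => ?_
  rw [← setLIntegral_Ioo_comp_sub
    (φ := fun β => ENNReal.ofReal (‖g (α - θ) - g β‖ ^ 2 * |Real.sin (α - θ - β)| ^ (-(1 + a))))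
    (fun β => by simp only [hg β, hs']) θ]
  simp only [sub_sub_sub_cancel_right]

/-- The squared `L²` norm over a period. -/
def circleNormSq (g : ℝ → ℂ) : ℝ≥0∞ := ∫⁻ t in Ioo 0 π, ENNReal.ofReal (‖g t‖ ^ 2)

theorem norm_sub_sq_mul_le {a : ℝ} (ha : a ≤ 1) (g : ℝ → ℂ) (α β : ℝ) :
    ‖g α - g β‖ ^ 2 * |Real.sin (α - β)| ^ (-(1 + a)) ≤
      2 * (‖Complex.exp (2 * Complex.I * α) * g α - Complex.exp (2 * Complex.I * β) * g β‖ ^ 2 *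
        |Real.sin (α - β)| ^ (-(1 + a))) + 8 * ‖g β‖ ^ 2 := by
  have e1 : ‖Complex.exp (2 * Complex.I * α)‖ = 1 := by
    rw [Complex.norm_exp]; simp
  have e1' : ‖Complex.exp (2 * Complex.I * β)‖ = 1 := by
    rw [Complex.norm_exp]; simp
  have e2 : ‖Complex.exp (2 * Complex.I * β) - Complex.exp (2 * Complex.I * α)‖ =
      2 * |Real.sin (α - β)| := by
    have h : Complex.exp (2 * Complex.I * α) =
        Complex.exp (2 * Complex.I * β) * Complex.exp (Complex.I * ((2 * (α - β) : ℝ) : ℂ)) := by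
      rw [← Complex.exp_add]
      congr 1
      push_cast
      ring
    rw [h, show ∀ z w : ℂ, z - z * w = -(z * (w - 1)) by intros; ring, norm_neg, norm_mul, e1',
      one_mul, Complex.norm_exp_I_mul_ofReal_sub_one, Real.norm_eq_abs, abs_mul, abs_two,
      mul_div_cancel_left₀ _ two_ne_zero]
  have h1 : ‖g α - g β‖ ≤
      ‖Complex.exp (2 * Complex.I * α) * g α - Complex.exp (2 * Complex.I * β) * g β‖ +
        2 * |Real.sin (α - β)| * ‖g β‖ := by
    rw [← e2, ← norm_mul, ← one_mul ‖g α - g β‖, ← e1, ← norm_mul]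
    refine le_trans (le_of_eq ?_) (norm_add_le _ _)
    congr 1
    ring
  have h2 : ‖g α - g β‖ ^ 2 ≤
      2 * ‖Complex.exp (2 * Complex.I * α) * g α - Complex.exp (2 * Complex.I * β) * g β‖ ^ 2 +
        8 * (|Real.sin (α - β)| ^ 2 * ‖g β‖ ^ 2) := by
    set d := ‖Complex.exp (2 * Complex.I * α) * g α - Complex.exp (2 * Complex.I * β) * g β‖
    set e := |Real.sin (α - β)| * ‖g β‖ with he
    have h3 : ‖g α - g β‖ ≤ d + 2 * e := by rw [he, ← mul_assoc]; exact h1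
    rw [← mul_pow, ← he]
    nlinarith [sq_nonneg (d - 2 * e), norm_nonneg (g α - g β)]
  have h3 : |Real.sin (α - β)| ^ 2 * |Real.sin (α - β)| ^ (-(1 + a)) ≤ 1 := by
    rcases eq_or_lt_of_le (abs_nonneg (Real.sin (α - β))) with h | h
    · rw [← h]; simp
    · rw [← Real.rpow_natCast, ← Real.rpow_add h]
      exact Real.rpow_le_one h.le (Real.abs_sin_le_one _) (by push_cast; linarith)
  calc _ ≤ _ := mul_le_mul_of_nonneg_right h2 (by positivity)
    _ = 2 * (‖Complex.exp (2 * Complex.I * α) * g α - Complex.exp (2 * Complex.I * β) * g β‖ ^ 2 *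
        |Real.sin (α - β)| ^ (-(1 + a))) +
        8 * (|Real.sin (α - β)| ^ 2 * |Real.sin (α - β)| ^ (-(1 + a)) * ‖g β‖ ^ 2) := by ring
    _ ≤ 2 * (‖Complex.exp (2 * Complex.I * α) * g α - Complex.exp (2 * Complex.I * β) * g β‖ ^ 2 *
        |Real.sin (α - β)| ^ (-(1 + a))) + 8 * (1 * ‖g β‖ ^ 2) := by gcongr
    _ = _ := by ring

theorem conformalEnergy_le_twist {a : ℝ} (ha : a ≤ 1) {g : ℝ → ℂ} (hg : Continuous g) :
    conformalEnergy a g ≤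
      2 * conformalEnergy a (fun t => Complex.exp (2 * Complex.I * t) * g t) +
        ENNReal.ofReal (8 * π) * circleNormSq g := by
  rw [conformalEnergy_eq, conformalEnergy_eq]
  have hN : ENNReal.ofReal (8 * π) * circleNormSq g =
      ∫⁻ _ in Ioo 0 π, 8 * circleNormSq g := by
    rw [setLIntegral_const, Real.volume_Ioo, sub_zero, ENNReal.ofReal_mul (by norm_num),
      ENNReal.ofReal_ofNat]
    ring
  rw [hN, ← lintegral_const_mul' _ _ (by simp), ← lintegral_add_right _ measurable_const]
  refine lintegral_mono fun α => ?_
  have hm : Measurable fun β => 8 * ENNReal.ofReal (‖g β‖ ^ 2) := by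
    have := hg.measurable
    fun_prop
  rw [circleNormSq, ← lintegral_const_mul' _ _ (by simp), ← lintegral_const_mul' _ _ (by simp),
    ← lintegral_add_right _ hm]
  refine lintegral_mono fun β => ?_
  rw [← ENNReal.ofReal_ofNat 2, ← ENNReal.ofReal_ofNat 8, ← ENNReal.ofReal_mul (by positivity),
    ← ENNReal.ofReal_mul (by positivity), ← ENNReal.ofReal_add (by positivity) (by positivity)]
  exact ENNReal.ofReal_le_ofReal (norm_sub_sq_mul_le ha g α β)

theorem circleNormSq_le_hardyEnergy {a : ℝ} (ha : 0 ≤ a) {g P : ℝ → ℂ}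
    (hP : ∀ t, ‖P t‖ = ‖g t‖) {c : ℂ} (hc : c.re = (1 - a) / 2) :
    circleNormSq g ≤ hardyEnergy a (weighted c P) := by
  rw [circleNormSq, lintegral_Ioo_zero_pi]
  refine lintegral_mono_ae ?_
  filter_upwards [Measure.ae_ne volume (0 : ℝ)] with x hx
  have hx0 : 0 < |x| := abs_pos.2 hx
  have hw : 0 < 1 + x ^ 2 := by positivity
  rw [← ENNReal.ofReal_mul (by positivity)]
  refine ENNReal.ofReal_le_ofReal ?_
  have hsq : ((1 + x ^ 2) ^ (-((1 - a) / 2))) ^ 2 =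
      (1 + x ^ 2) ^ (-((1 - a) / 2) * ((2 : ℕ) : ℝ)) := by
    rw [Real.rpow_mul hw.le, Real.rpow_natCast]
  rw [norm_weighted, hP, hc, mul_pow, hsq, mul_right_comm]
  gcongr
  have h1 : (1 + x ^ 2) ^ (-(a / 2)) ≤ |x| ^ (-a) := by
    have h2 : |x| ^ (-a) = (x ^ 2) ^ (-(a / 2)) := by
      rw [← sq_abs, ← Real.rpow_natCast, ← Real.rpow_mul hx0.le]
      congr 1
      push_cast
      ring
    rw [h2]
    exact Real.rpow_le_rpow_of_nonpos (by positivity) (by linarith) (by linarith)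
  calc (1 + x ^ 2)⁻¹ = (1 + x ^ 2) ^ (-1 : ℝ) := (Real.rpow_neg_one _).symm
    _ ≤ (1 + x ^ 2) ^ (-((1 - a) / 2) * ((2 : ℕ) : ℝ) + -(a / 2)) :=
        Real.rpow_le_rpow_of_exponent_le (by nlinarith) (by push_cast; linarith)
    _ = (1 + x ^ 2) ^ (-((1 - a) / 2) * ((2 : ℕ) : ℝ)) * (1 + x ^ 2) ^ (-(a / 2)) :=
        Real.rpow_add hw _ _
    _ ≤ _ := by gcongr

theorem norm_mul_sub_mul_sq_le (p q A B : ℂ) :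
    ‖p * A - q * B‖ ^ 2 ≤
      2 * (‖p‖ * ‖q‖ * ‖A - B‖ ^ 2) + 2 * ((‖A‖ ^ 2 + ‖B‖ ^ 2) * ‖p - q‖ ^ 2) := by
  wlog hpq : ‖p‖ ≤ ‖q‖ generalizing p q A B
  · have h := this q p B A (le_of_not_ge hpq)
    rw [norm_sub_rev, norm_sub_rev A, norm_sub_rev p]
    linarith
  have h1 : ‖p * A - q * B‖ ≤ ‖p‖ * ‖A - B‖ + ‖p - q‖ * ‖B‖ := by
    rw [show p * A - q * B = p * (A - B) + (p - q) * B by ring, ← norm_mul, ← norm_mul]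
    exact norm_add_le _ _
  have h2 : ‖p * A - q * B‖ ^ 2 ≤ 2 * (‖p‖ * ‖A - B‖) ^ 2 + 2 * (‖p - q‖ * ‖B‖) ^ 2 := by
    nlinarith [sq_nonneg (‖p‖ * ‖A - B‖ - ‖p - q‖ * ‖B‖), norm_nonneg (p * A - q * B)]
  have h3 : ‖p‖ ^ 2 * ‖A - B‖ ^ 2 ≤ ‖p‖ * ‖q‖ * ‖A - B‖ ^ 2 := by
    rw [sq ‖p‖]
    gcongr
  have h4 : 0 ≤ ‖A‖ ^ 2 * ‖p - q‖ ^ 2 := by positivity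
  nlinarith

theorem hasDerivAt_exp_I_mul (t : ℝ) :
    HasDerivAt (fun t : ℝ => Complex.exp (Complex.I * t)) (Complex.I * Complex.exp (Complex.I * t))
      t := by
  have h := ((Complex.ofRealCLM.hasDerivAt (x := t)).const_mul Complex.I).cexp
  refine h.congr_deriv ?_
  simp [mul_comm]

/-- The rotate by `θ` of the vector with circle profile `e^{it} g(t)`. -/
def rotated (c : ℂ) (g : ℝ → ℂ) (θ : ℝ) : ℝ → ℂ :=
  weighted c fun t => Complex.exp (Complex.I * ((t - θ : ℝ) : ℂ)) * g (t - θ)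

theorem norm_rotated_sub_sq_le {a : ℝ} (ha : 0 ≤ a) {c : ℂ} (hc : c.re = 1 / 2) (g : ℝ → ℂ)
    (θ x y : ℝ) :
    ‖rotated c g θ x - rotated c g θ y‖ ^ 2 ≤
      2 * (((1 + x ^ 2) ^ (-((1 - a) / 2)) * (1 + y ^ 2) ^ (-((1 - a) / 2))) *
        ‖g (arccot x - θ) - g (arccot y - θ)‖ ^ 2) +
      2 * ((‖g (arccot x - θ)‖ ^ 2 + ‖g (arccot y - θ)‖ ^ 2) *
        ‖weighted c (fun t => Complex.exp (Complex.I * t)) x -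
          weighted c (fun t => Complex.exp (Complex.I * t)) y‖ ^ 2) := by
  set E : ℝ → ℂ := fun t => Complex.exp (Complex.I * t) with hE
  have hw : ∀ x, ‖weighted c E x‖ ≤ (1 + x ^ 2) ^ (-((1 - a) / 2)) := by
    intro x
    rw [norm_weighted, hc, hE]
    simp only
    rw [mul_comm Complex.I, Complex.norm_exp_ofReal_mul_I, mul_one]
    exact Real.rpow_le_rpow_of_exponent_le (by nlinarith) (by linarith)
  have hr : ∀ x, rotated c g θ x =
      Complex.exp (-(Complex.I * θ)) * (weighted c E x * g (arccot x - θ)) := by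
    intro x
    simp only [rotated, weighted, hE]
    have : Complex.exp (Complex.I * ((arccot x - θ : ℝ) : ℂ)) =
        Complex.exp (-(Complex.I * θ)) * Complex.exp (Complex.I * (arccot x : ℂ)) := by
      rw [← Complex.exp_add]
      congr 1
      push_cast
      ring
    rw [this]
    ring
  have hn : ‖Complex.exp (-(Complex.I * θ))‖ = 1 := by
    rw [Complex.norm_exp]
    simp
  rw [hr, hr, ← mul_sub, norm_mul, hn, one_mul]
  refine (norm_mul_sub_mul_sq_le _ _ _ _).trans ?_
  gcongr
  · exact hw x
  · exact hw y

theorem gagliardo_rotated_le {a : ℝ} (ha : 0 ≤ a) {c : ℂ} (hc : c.re = 1 / 2) {g : ℝ → ℂ}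
    (hg : Continuous g) (hper : Function.Periodic g π) (θ : ℝ) :
    gagliardo a (rotated c g θ) ≤ 2 * conformalEnergy a g +
      4 * ∫⁻ x, ENNReal.ofReal (‖g (arccot x - θ)‖ ^ 2) * ∫⁻ y, ENNReal.ofReal
        (‖weighted c (fun t => Complex.exp (Complex.I * t)) x -
          weighted c (fun t => Complex.exp (Complex.I * t)) y‖ ^ 2 * |x - y| ^ (-(1 + a))) := by
  have hfc : Continuous (weighted c (fun t => Complex.exp (Complex.I * t))) :=
    (continuous_one_add_sq_cpow _).mul
      ((by fun_prop : Continuous fun t : ℝ => Complex.exp (Complex.I * t)).comp continuous_arccot)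
  have hle := fun x y => norm_rotated_sub_sq_le ha hc g θ x y
  generalize weighted c (fun t => Complex.exp (Complex.I * t)) = f at *
  rw [← conformalEnergy_comp_sub a hper θ]
  have hA := continuous_arccot.measurable
  have hgm := hg.measurable
  have hφ : Measurable fun x => ENNReal.ofReal (‖g (arccot x - θ)‖ ^ 2) := by fun_prop
  have hψ : Measurable (Function.uncurry fun x y =>
      ENNReal.ofReal (‖f x - f y‖ ^ 2 * |x - y| ^ (-(1 + a)))) := by
    have := hfc.measurable
    simp only [Function.uncurry_def]
    fun_prop
  have hm : Measurable (Function.uncurry fun x y : ℝ => 2 * ENNReal.ofReal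
      (((1 + x ^ 2) ^ (-((1 - a) / 2)) * (1 + y ^ 2) ^ (-((1 - a) / 2))) *
        ‖g (arccot x - θ) - g (arccot y - θ)‖ ^ 2 * |x - y| ^ (-(1 + a)))) := by
    simp only [Function.uncurry_def]
    fun_prop
  have hsym := lintegral_lintegral_add_mul_of_symm hφ hψ fun x y => by
    rw [norm_sub_rev, abs_sub_comm]
  calc gagliardo a (rotated c g θ)
      ≤ ∫⁻ x, ∫⁻ y, (2 * ENNReal.ofReal
          (((1 + x ^ 2) ^ (-((1 - a) / 2)) * (1 + y ^ 2) ^ (-((1 - a) / 2))) *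
            ‖g (arccot x - θ) - g (arccot y - θ)‖ ^ 2 * |x - y| ^ (-(1 + a))) +
          2 * ((ENNReal.ofReal (‖g (arccot x - θ)‖ ^ 2) + ENNReal.ofReal (‖g (arccot y - θ)‖ ^ 2)) *
            ENNReal.ofReal (‖f x - f y‖ ^ 2 * |x - y| ^ (-(1 + a))))) := by
        refine lintegral_mono fun x => lintegral_mono fun y => ?_
        dsimp only
        rw [← ENNReal.ofReal_add (by positivity) (by positivity),
          ← ENNReal.ofReal_mul (by positivity), ← ENNReal.ofReal_ofNat 2,
          ← ENNReal.ofReal_mul (by positivity), ← ENNReal.ofReal_mul (by positivity),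
          ← ENNReal.ofReal_add (by positivity) (by positivity)]
        refine ENNReal.ofReal_le_ofReal ?_
        calc _ ≤ _ := mul_le_mul_of_nonneg_right (hle x y) (by positivity)
          _ = _ := by ring
    _ = 2 * conformalEnergy a (fun t => g (t - θ)) + 2 * (2 * ∫⁻ x, ∫⁻ y,
          ENNReal.ofReal (‖g (arccot x - θ)‖ ^ 2) *
            ENNReal.ofReal (‖f x - f y‖ ^ 2 * |x - y| ^ (-(1 + a)))) := by
        rw [lintegral_lintegral_add hm, lintegral_lintegral_const_mul (by simp),
          lintegral_lintegral_const_mul (by simp), hsym, conformalEnergy]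
    _ = _ := by
        rw [← mul_assoc 2 2, show (2 : ℝ≥0∞) * 2 = 4 by norm_num]
        congr 2
        exact lintegral_congr fun x => lintegral_const_mul' _ _ ENNReal.ofReal_ne_top

theorem lintegral_gagliardo_rotated_le {a : ℝ} (ha : 0 ≤ a) {c : ℂ} (hc : c.re = 1 / 2)
    {g : ℝ → ℂ} (hg : Continuous g) (hper : Function.Periodic g π) :
    ∫⁻ θ in Ioc 0 (2 * π), gagliardo a (rotated c g θ) ≤
      ENNReal.ofReal (4 * π) * conformalEnergy a g +
        8 * gagliardo a (weighted c fun t => Complex.exp (Complex.I * t)) * circleNormSq g := by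
  set f := weighted c (fun t => Complex.exp (Complex.I * t)) with hf
  have hfc : Continuous f :=
    (continuous_one_add_sq_cpow _).mul
      ((by fun_prop : Continuous fun t : ℝ => Complex.exp (Complex.I * t)).comp continuous_arccot)
  have hΛ : Measurable fun x =>
      ∫⁻ y, ENNReal.ofReal (‖f x - f y‖ ^ 2 * |x - y| ^ (-(1 + a))) :=
    (measurable_gagliardo_kernel hfc a).lintegral_prod_right'
  have hgm : Measurable fun p : ℝ × ℝ => g (arccot p.2 - p.1) :=
    (hg.comp ((continuous_arccot.comp continuous_snd).sub continuous_fst)).measurable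
  have hm : Measurable (Function.uncurry fun θ x => ENNReal.ofReal (‖g (arccot x - θ)‖ ^ 2) *
      ∫⁻ y, ENNReal.ofReal (‖f x - f y‖ ^ 2 * |x - y| ^ (-(1 + a)))) :=
    hgm.norm.pow_const 2 |>.ennreal_ofReal.mul (hΛ.comp measurable_snd)
  calc _ ≤ ∫⁻ θ in Ioc 0 (2 * π), (2 * conformalEnergy a g +
        4 * ∫⁻ x, ENNReal.ofReal (‖g (arccot x - θ)‖ ^ 2) *
          ∫⁻ y, ENNReal.ofReal (‖f x - f y‖ ^ 2 * |x - y| ^ (-(1 + a)))) :=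
        lintegral_mono fun θ => gagliardo_rotated_le ha hc hg hper θ
    _ = ENNReal.ofReal (4 * π) * conformalEnergy a g +
        4 * ∫⁻ x, 2 * circleNormSq g *
          ∫⁻ y, ENNReal.ofReal (‖f x - f y‖ ^ 2 * |x - y| ^ (-(1 + a))) := by
        rw [lintegral_add_left measurable_const, setLIntegral_const,
          lintegral_const_mul' _ _ (by simp), lintegral_lintegral_swap hm.aemeasurable]
        congr 1
        · rw [Real.volume_Ioc, sub_zero, show 4 * π = 2 * (2 * π) by ring,
            ENNReal.ofReal_mul (p := 2) (q := 2 * π) (by norm_num), ENNReal.ofReal_ofNat,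
            mul_right_comm]
        · congr 1
          refine lintegral_congr fun x => ?_
          have hmx : Measurable fun θ => ENNReal.ofReal (‖g (arccot x - θ)‖ ^ 2) :=
            (hgm.comp measurable_prodMk_right).norm.pow_const 2 |>.ennreal_ofReal
          rw [lintegral_mul_const _ hmx]
          congr 1
          exact setLIntegral_Ioc_comp_sub_left (φ := fun t => ENNReal.ofReal (‖g t‖ ^ 2))
            (fun t => by simp only [hper t]) _
    _ = _ := by
        rw [lintegral_const_mul _ hΛ, gagliardo]
        ring

theorem exp_I_mul_arccot (y : ℝ) :
    Complex.exp (Complex.I * (arccot y : ℂ)) = (y + Complex.I) / (√(1 + y ^ 2) : ℝ) := by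
  rw [mul_comm, Complex.exp_mul_I, ← Complex.ofReal_cos, ← Complex.ofReal_sin, sin_arccot,
    cos_arccot]
  push_cast
  ring

theorem sign_mul_exp_arccot {x θ D N : ℝ} (hD : D = Real.cos θ - x * Real.sin θ)
    (hN : N = x * Real.cos θ + Real.sin θ) (h0 : D ≠ 0) :
    (Real.sign D : ℂ) * Complex.exp (Complex.I * (arccot (N / D) : ℂ)) =
      Complex.exp (Complex.I * ((arccot x - θ : ℝ) : ℂ)) := by
  have hsq : D ^ 2 + N ^ 2 = 1 + x ^ 2 := by
    rw [hD, hN]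
    linear_combination (1 + x ^ 2) * Real.sin_sq_add_cos_sq θ
  have hs : 0 < √(1 + x ^ 2) := by positivity
  have hroot : √(1 + (N / D) ^ 2) = √(1 + x ^ 2) / |D| := by
    rw [← Real.sqrt_sq_eq_abs, ← Real.sqrt_div (by positivity), ← hsq]
    congr 1
    field_simp
  have hrhs : Complex.exp (Complex.I * ((arccot x - θ : ℝ) : ℂ)) =
      (N + D * Complex.I) / (√(1 + x ^ 2) : ℝ) := by
    rw [Complex.ofReal_sub, mul_sub, Complex.exp_sub, exp_I_mul_arccot, mul_comm Complex.I,
      Complex.exp_mul_I, hD, hN, div_div, div_eq_div_iff]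
    · push_cast
      have h := Complex.sin_sq_add_cos_sq (θ : ℂ)
      have hI := Complex.I_sq
      linear_combination (-(√(1 + x ^ 2) : ℝ) * (x + Complex.I) : ℂ) * h +
        ((√(1 + x ^ 2) : ℝ) * (x * Complex.sin θ ^ 2 - Complex.cos θ * Complex.sin θ) : ℂ) * hI
    · refine mul_ne_zero (by exact_mod_cast hs.ne') ?_
      rw [← Complex.exp_mul_I]
      exact Complex.exp_ne_zero _
    · exact_mod_cast hs.ne'
  rw [hrhs, exp_I_mul_arccot, hroot]
  have hDc : (D : ℂ) ≠ 0 := by exact_mod_cast h0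
  have hsc : ((√(1 + x ^ 2) : ℝ) : ℂ) ≠ 0 := by exact_mod_cast hs.ne'
  rcases lt_or_gt_of_ne h0 with h | h
  · rw [Real.sign_of_neg h, abs_of_neg h]
    push_cast
    field_simp
  · rw [Real.sign_of_pos h, abs_of_pos h]
    push_cast
    field_simp

theorem comp_arccot_eq_of_periodic {g : ℝ → ℂ} (hper : Function.Periodic g π) {x θ D N : ℝ}
    (hD : D = Real.cos θ - x * Real.sin θ) (hN : N = x * Real.cos θ + Real.sin θ) (h0 : D ≠ 0) :
    g (arccot (N / D)) = g (arccot x - θ) := by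
  have h := sign_mul_exp_arccot hD hN h0
  have hsign : (Real.sign D : ℂ) ^ 2 = 1 := by
    rcases lt_or_gt_of_ne h0 with h | h
    · rw [Real.sign_of_neg h]; norm_num
    · rw [Real.sign_of_pos h]; norm_num
  have h2 : Complex.exp (2 * (Complex.I * (arccot (N / D) : ℂ))) =
      Complex.exp (2 * (Complex.I * ((arccot x - θ : ℝ) : ℂ))) := by
    rw [two_mul, two_mul, Complex.exp_add, Complex.exp_add, ← h]
    linear_combination (-Complex.exp (Complex.I * (arccot (N / D) : ℂ)) ^ 2) * hsign
  obtain ⟨n, hn⟩ := Complex.exp_eq_exp_iff_exists_int.1 h2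
  have h3 : arccot (N / D) = arccot x - θ + n * π := by
    have h4 : (2 * Complex.I) * (arccot (N / D) : ℂ) =
        (2 * Complex.I) * ((arccot x - θ + n * π : ℝ) : ℂ) := by
      push_cast at hn ⊢
      linear_combination hn
    exact_mod_cast mul_left_cancel₀ (by simp) h4
  rw [h3]
  exact hper.int_mul n _

theorem piMinus_eq_rotated {lam θ x : ℝ} {g : ℝ → ℂ} (hper : Function.Periodic g π)
    (h0 : Real.cos θ - x * Real.sin θ ≠ 0) :
    piMinus (Complex.I * lam) θ (fun x : ℝ => ((1 + x ^ 2 : ℝ) : ℂ) ^ (-(1 + Complex.I * lam) / 2) *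
      Complex.exp (Complex.I * (arccot x : ℂ)) * g (arccot x)) x =
    rotated ((1 + Complex.I * lam) / 2) g θ x := by
  obtain ⟨D, hD⟩ : ∃ D, D = Real.cos θ - x * Real.sin θ := ⟨_, rfl⟩
  obtain ⟨N, hN⟩ : ∃ N, N = x * Real.cos θ + Real.sin θ := ⟨_, rfl⟩
  simp only [piMinus, rotated, weighted, ← hD, ← hN]
  rw [← hD] at h0
  rw [← sign_mul_exp_arccot hD hN h0, comp_arccot_eq_of_periodic hper hD hN h0]
  have hsq : D ^ 2 + N ^ 2 = 1 + x ^ 2 := by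
    rw [hD, hN]
    linear_combination (1 + x ^ 2) * Real.sin_sq_add_cos_sq θ
  have hpow : ((|D| : ℝ) : ℂ) ^ (-1 - Complex.I * lam) *
      ((1 + (N / D) ^ 2 : ℝ) : ℂ) ^ (-(1 + Complex.I * lam) / 2) =
      ((1 + x ^ 2 : ℝ) : ℂ) ^ (-((1 + Complex.I * lam) / 2)) := by
    have h1 : ((|D| : ℝ) : ℂ) ^ (-1 - Complex.I * lam) =
        ((|D| ^ 2 : ℝ) : ℂ) ^ (-(1 + Complex.I * lam) / 2) := by
      have hD0 : ((|D| : ℝ) : ℂ) ≠ 0 := by exact_mod_cast (abs_pos.2 h0).ne'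
      rw [sq, Complex.ofReal_mul, Complex.mul_cpow_ofReal_nonneg (abs_nonneg _) (abs_nonneg _),
        ← Complex.cpow_add _ _ hD0]
      congr 1
      ring
    rw [h1, ← Complex.mul_cpow_ofReal_nonneg (by positivity) (by positivity), ← Complex.ofReal_mul,
      sq_abs, ← hsq]
    congr 1
    · congr 1
      field_simp
    · ring
  rw [← hpow]
  ring

theorem ae_cos_sub_mul_sin_ne_zero (θ : ℝ) : ∀ᵐ x : ℝ, Real.cos θ - x * Real.sin θ ≠ 0 := by
  rcases eq_or_ne (Real.sin θ) 0 with h | h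
  · refine Filter.Eventually.of_forall fun x => ?_
    rw [h, mul_zero, sub_zero]
    intro hc
    have := Real.sin_sq_add_cos_sq θ
    rw [h, hc] at this
    norm_num at this
  · filter_upwards [Measure.ae_ne volume (Real.cos θ / Real.sin θ)] with x hx h2
    refine hx ?_
    rw [eq_div_iff h]
    linarith

theorem IsImpFT.congr_ae {f g : ℝ → ℂ} {ξ : ℝ} {z : ℂ} (h : IsImpFT f ξ z)
    (hfg : f =ᵐ[volume] g) : IsImpFT g ξ z := by
  refine h.congr fun R => integral_congr_ae ?_
  filter_upwards [ae_restrict_of_ae hfg] with x hx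
  rw [hx]

theorem exists_energy_le {a : ℝ} (ha : a ∈ Ioo (0 : ℝ) 1) {c : ℂ} (hc : c.re = 1 / 2) :
    ∃ C : ℝ≥0∞, C ≠ ∞ ∧ ∀ g : ℝ → ℂ, Continuous g → Function.Periodic g π →
      ∫⁻ θ in Ioc 0 (2 * π), gagliardo a (rotated c g θ) ≤
        C * gagliardo a (weighted ((1 - a) / 2 : ℝ)
          fun t => Complex.exp (2 * Complex.I * t) * g t) := by
  obtain ⟨H, hH⟩ := exists_hardyEnergy_le ha
  obtain ⟨C, hC⟩ := exists_conformalEnergy_le ha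
  have hf := gagliardo_weighted_lt_top ha hc hasDerivAt_exp_I_mul
    (by fun_prop : Continuous fun t : ℝ => Complex.I * Complex.exp (Complex.I * t))
  set B := gagliardo a (weighted c fun t => Complex.exp (Complex.I * t)) with hB
  refine ⟨ENNReal.ofReal (4 * π) * (2 * (2 + C * H) + ENNReal.ofReal (8 * π) * H) + 8 * B * H,
    ?_, fun g hg hper => ?_⟩
  · refine ENNReal.add_ne_top.2 ⟨ENNReal.mul_ne_top ENNReal.ofReal_ne_top
      (ENNReal.add_ne_top.2 ⟨?_, ?_⟩), ?_⟩
    · exact ENNReal.mul_ne_top (by simp) (ENNReal.add_ne_top.2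
        ⟨by simp, ENNReal.mul_ne_top ENNReal.coe_ne_top ENNReal.coe_ne_top⟩)
    · exact ENNReal.mul_ne_top ENNReal.ofReal_ne_top ENNReal.coe_ne_top
    · exact ENNReal.mul_ne_top (ENNReal.mul_ne_top (by simp) hf.ne) ENNReal.coe_ne_top
  have hPc : Continuous fun t : ℝ => Complex.exp (2 * Complex.I * t) * g t := by fun_prop
  have h1 := lintegral_gagliardo_rotated_le ha.1.le hc hg hper
  have h2 := conformalEnergy_le_twist ha.2.le hg
  have h3 := hC _ hPc
  have hre : (((1 - a) / 2 : ℝ) : ℂ).re = (1 - a) / 2 := Complex.ofReal_re _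
  have h4 := circleNormSq_le_hardyEnergy (g := g) (P := fun t =>
    Complex.exp (2 * Complex.I * t) * g t) ha.1.le (fun t => by
      rw [norm_mul, Complex.norm_exp]; simp) hre
  have hfc : Continuous (weighted (((1 - a) / 2 : ℝ) : ℂ)
      fun t => Complex.exp (2 * Complex.I * t) * g t) :=
    (continuous_one_add_sq_cpow _).mul (hPc.comp continuous_arccot)
  have h5 := hH _ hfc (hardyEnergy_weighted_ne_top ha hre hPc)
  rw [← hB] at h1
  generalize weighted (((1 - a) / 2 : ℝ) : ℂ)
    (fun t => Complex.exp (2 * Complex.I * t) * g t) = f at *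
  calc _ ≤ _ := h1
    _ ≤ ENNReal.ofReal (4 * π) * (2 * (2 * gagliardo a f + C * (H * gagliardo a f)) +
        ENNReal.ofReal (8 * π) * (H * gagliardo a f)) + 8 * B * (H * gagliardo a f) := by
      gcongr
      · refine h2.trans ?_
        gcongr
        · refine h3.trans ?_
          gcongr
        · exact h4.trans h5
      · exact h4.trans h5
    _ = _ := by ring

theorem contDiff_exp_mul (k : ℂ) : ContDiff ℝ 1 fun t : ℝ => Complex.exp (k * t) :=
  (contDiff_const.mul Complex.ofRealCLM.contDiff).cexp

theorem isDecayingC1_weighted_of_contDiff {c : ℂ} (hc : 0 < c.re) {P : ℝ → ℂ}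
    (hP : ContDiff ℝ 1 P) : IsDecayingC1 (weighted c P) (weightedDeriv c P (deriv P)) :=
  isDecayingC1_weighted hc (fun t => (hP.differentiable one_ne_zero t).hasDerivAt)
    (hP.continuous_deriv le_rfl)

/-- for `u ∈ (−1,0)`, `λ ∈ ℝ`, there is `c_u > 0` such that every smooth
vector `v(x) = (1+x²)^{−(1+iλ)/2} e^{i arccot x} g(arccot x)` of `P(iλ,−)^∞` (with `g`
smooth and `π`-periodic, i.e. `g = Φ(e^{2iθ})` for smooth `Φ` on the circle) satisfies
`⫴v⫴²_u ≤ c_u ‖(1+x²)^{(iλ−u)/2} e^{i arccot x} v(x)‖²_{C_u}`, the improper Fourier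
transforms existing for `ξ ≠ 0`. -/
theorem stmt17 (u lam : ℝ) (hu : u ∈ Set.Ioo (-1 : ℝ) 0) :
    ∃ c : ℝ, 0 < c ∧
      ∀ g : ℝ → ℂ, ContDiff ℝ (⊤ : ℕ∞) g → (∀ θ : ℝ, g (θ + Real.pi) = g θ) →
        ∀ v : ℝ → ℂ,
          (v = fun x : ℝ =>
            ((1 + x ^ 2 : ℝ) : ℂ) ^ (-(1 + Complex.I * lam) / 2) *
              Complex.exp (Complex.I * (arccot x : ℂ)) * g (arccot x)) →
        ∃ F : ℝ → ℝ → ℂ, ∃ G : ℝ → ℂ,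
          (∀ θ : ℝ, ∀ ξ : ℝ, ξ ≠ 0 → IsImpFT (piMinus (Complex.I * lam) θ v) ξ (F θ ξ)) ∧
          (∀ ξ : ℝ, ξ ≠ 0 →
            IsImpFT (fun x : ℝ =>
              ((1 + x ^ 2 : ℝ) : ℂ) ^ ((Complex.I * lam - u) / 2) *
                Complex.exp (Complex.I * (arccot x : ℂ)) * v x) ξ (G ξ)) ∧
          (∫⁻ θ in Ioc (0:ℝ) (2 * π),
              ∫⁻ ξ : ℝ, ENNReal.ofReal (|ξ| ^ (-u)) * (‖F θ ξ‖₊ : ℝ≥0∞) ^ 2)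
            ≤ ENNReal.ofReal c *
                (∫⁻ ξ : ℝ, ENNReal.ofReal (|ξ| ^ (-u)) * (‖G ξ‖₊ : ℝ≥0∞) ^ 2) := by
  have ha : -u ∈ Ioo (0 : ℝ) 1 := ⟨by linarith [hu.2], by linarith [hu.1]⟩
  have hc : ((1 + Complex.I * lam) / 2 : ℂ).re = 1 / 2 := by simp
  obtain ⟨C, hC, hCle⟩ := exists_energy_le ha hc
  refine ⟨C.toReal + 1, by positivity, fun g hg hper v hv => ?_⟩
  have hg1 : ContDiff ℝ 1 g := hg.of_le (by exact_mod_cast le_top)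
  have hF : ∀ θ, IsDecayingC1 (rotated ((1 + Complex.I * lam) / 2) g θ) _ := fun θ =>
    isDecayingC1_weighted_of_contDiff (by rw [hc]; norm_num)
      ((contDiff_exp_mul Complex.I).mul hg1 |>.comp (contDiff_id.sub contDiff_const))
  have hG := isDecayingC1_weighted_of_contDiff (c := ((1 - -u) / 2 : ℝ))
    (by rw [Complex.ofReal_re]; linarith [ha.2, hu.1]) ((contDiff_exp_mul (2 * Complex.I)).mul hg1)
  refine ⟨fun θ => derivFT _, derivFT _, fun θ ξ hξ => ((hF θ).isImpFT hξ).congr_ae ?_,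
    fun ξ hξ => (hG.isImpFT hξ).congr_ae (.of_forall fun x => ?_), ?_⟩
  · filter_upwards [ae_cos_sub_mul_sin_ne_zero θ] with x hx
    rw [hv, piMinus_eq_rotated hper hx]
  · have h0 : ((1 + x ^ 2 : ℝ) : ℂ) ≠ 0 := by
      exact_mod_cast (by positivity : (1 + x ^ 2 : ℝ) ≠ 0)
    have hw : -(((1 - -u) / 2 : ℝ) : ℂ) =
        (Complex.I * lam - u) / 2 + -(1 + Complex.I * lam) / 2 := by
      push_cast
      ring
    simp only [hv, weighted]
    rw [hw, Complex.cpow_add _ _ h0, mul_assoc 2, two_mul, Complex.exp_add]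
    ring
  · have hK := gagliardoConst_ne_zero (-u)
    have hK' := (gagliardoConst_lt_top ha).ne
    have h := hCle g hg.continuous hper
    rw [hG.gagliardo_eq] at h
    simp only [fun θ => (hF θ).gagliardo_eq (-u)] at h
    rw [lintegral_const_mul' _ _ hK', mul_left_comm, ENNReal.mul_le_mul_iff_right hK hK'] at h
    refine h.trans (mul_le_mul_left ?_ _)
    rw [← ENNReal.ofReal_toReal hC]
    exact ENNReal.ofReal_le_ofReal (by simp)
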